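/- Among the 298 combinatorially inequivalent orientation-reversing gluing patterns of the faces of the octahedron, classified by the multiset of Euler characteristics of those vertex-class links that are not 2-spheres: exactly 37 have all vertex links 2-spheres (χ = 2), exactly 81 have non-sphere link data {0} (a single torus), exactly 9 have non-sphere link data {0, 0} (two tori), exactly 113 have non-sphere link data {−2} (a single genus-2 surface), exactly 2 have non-sphere link data {−2, 0}, and exactly 56 have non-sphere link data {−4} (a single genus-3 surface). -/

import Mathlib

/-! Combinatorial model of the octahedron and of orientation-reversing gluing
patterns of its faces, following Heard–Pervova–Petronio. -/

/-- Vertices of the octahedron `±e_i`, encoded as a pair (axis, sign). -/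
abbrev OctVertex : Type := Fin 3 × Bool

/-- Faces of the octahedron: a choice of a sign for each coordinate axis;
the face `F` has vertex set `{(i, F i) : i ∈ Fin 3}`. -/
abbrev OctFace : Type := Fin 3 → Bool

/-- The parity of a face.  The cyclic order (axis 0, axis 1, axis 2) of the vertices of
a face `F` agrees with the cyclic order induced by the outward orientation of the
boundary of the solid octahedron if and only if `faceSign F = true`. -/
def faceSign (F : OctFace) : Bool := Bool.xor (F 0) (Bool.xor (F 1) (F 2))

/-- `IsGluing σ π` says that the fixed-point-free involution `σ` of the set of faces,
together with the face identifications `π` (the bijection `φ_F` from the vertices of `F`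
to those of `σ F` sends the vertex of `F` on axis `i` to the vertex of `σ F` on axis
`π F i`), is an orientation-reversing gluing pattern: `φ_{σ F} = φ_F⁻¹` and every `φ_F`
reverses the cyclic orderings induced by the boundary orientation (a bijection
`F → σ F` given by `π` reverses them iff `sign (π) · faceSign F · faceSign (σ F) = -1`). -/
def IsGluing (σ : Equiv.Perm OctFace) (π : OctFace → Equiv.Perm (Fin 3)) : Prop :=
  (∀ F, σ (σ F) = F) ∧ (∀ F, σ F ≠ F) ∧ (∀ F, π (σ F) = (π F)⁻¹) ∧
    (∀ F, Equiv.Perm.sign (π F) = 1 ↔ faceSign F ≠ faceSign (σ F))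

instance : DecidablePred fun p : Equiv.Perm OctFace × (OctFace → Equiv.Perm (Fin 3)) =>
    IsGluing p.1 p.2 := fun p => by unfold IsGluing; infer_instance

/-- An orientation-reversing gluing pattern of the faces of the octahedron. -/
abbrev Gluing : Type :=
  {p : Equiv.Perm OctFace × (OctFace → Equiv.Perm (Fin 3)) // IsGluing p.1 p.2}

/-- The involution on faces underlying a gluing pattern. -/
def Gluing.face (g : Gluing) : Equiv.Perm OctFace := g.1.1

/-- The face identifications of a gluing pattern, as permutations of the axes. -/
def Gluing.axisMap (g : Gluing) : OctFace → Equiv.Perm (Fin 3) := g.1.2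

/-- The action of the symmetry of the octahedron given by the signed axis permutation
`(ρ, ε)` (sending the vertex `(i, b)` to `(ρ i, xor b (ε i))`) on faces. -/
def symMapFace (ρ : Equiv.Perm (Fin 3)) (ε : Fin 3 → Bool) (F : OctFace) : OctFace :=
  fun j => Bool.xor (F (ρ⁻¹ j)) (ε (ρ⁻¹ j))

/-- Two gluing patterns are combinatorially equivalent if some symmetry of the
octahedron conjugates one into the other. -/
def EquivGluing (g h : Gluing) : Prop :=
  ∃ (ρ : Equiv.Perm (Fin 3)) (ε : Fin 3 → Bool),
    (∀ F, h.face (symMapFace ρ ε F) = symMapFace ρ ε (g.face F)) ∧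
    (∀ F, h.axisMap (symMapFace ρ ε F) = ρ * g.axisMap F * ρ⁻¹)

/-- The combinatorial equivalence class (orbit under the symmetry group) of a gluing. -/
def orbit (g : Gluing) : Set Gluing := {h | EquivGluing g h}

/-- The identifications induced by a gluing pattern on the vertices of the octahedron:
the vertex of `F` on axis `i` is glued to the corresponding vertex of `face F`. -/
def vtxRel (g : Gluing) (v w : OctVertex) : Prop :=
  ∃ (F : OctFace) (i : Fin 3),
    v = (i, F i) ∧ w = (g.axisMap F i, g.face F (g.axisMap F i))

/-- The equivalence relation on vertices generated by the face identifications. -/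
def vtxSetoid (g : Gluing) : Setoid OctVertex := Relation.EqvGen.setoid (vtxRel g)

/-- The number of vertex classes of a gluing pattern. -/
noncomputable def vtxCount (g : Gluing) : ℕ := Nat.card (Quotient (vtxSetoid g))

/-- An edge-end (corner) of the octahedron: an ordered pair of vertices lying on
distinct axes; it represents the edge between them together with the choice of the
first vertex as its endpoint.  Edge-ends correspond to the corners of the
quadrilateral vertex links. -/
abbrev EdgeEnd : Type := {p : OctVertex × OctVertex // p.1.1 ≠ p.2.1}

/-- The identifications induced by a gluing pattern on edge-ends: an edge-end contained
in the face `F` is glued to the corresponding edge-end of `face F`. -/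
def endRel (g : Gluing) (p q : EdgeEnd) : Prop :=
  ∃ (F : OctFace) (i j : Fin 3), i ≠ j ∧ p.1 = ((i, F i), (j, F j)) ∧
    q.1 = ((g.axisMap F i, g.face F (g.axisMap F i)),
           (g.axisMap F j, g.face F (g.axisMap F j)))

/-- The equivalence relation on edge-ends generated by the face identifications.
Its classes are the vertices of the quadrangulated link surfaces of the vertex
classes. -/
def endSetoid (g : Gluing) : Setoid EdgeEnd := Relation.EqvGen.setoid (endRel g)

/-- The relation on edge-ends generating the edge identifications: face identifications
together with forgetting the choice of endpoint. -/
def edgeRel (g : Gluing) (p q : EdgeEnd) : Prop :=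
  endRel g p q ∨ q.1 = (p.1.2, p.1.1)

/-- The equivalence relation whose classes are the edge classes of a gluing pattern. -/
def edgeSetoid (g : Gluing) : Setoid EdgeEnd := Relation.EqvGen.setoid (edgeRel g)

/-- The number of edge classes of a gluing pattern. -/
noncomputable def edgeCount (g : Gluing) : ℕ := Nat.card (Quotient (edgeSetoid g))

/-- The number of vertices of the octahedron lying in the vertex class `c`; this is
the number of quadrilaterals tiling the link surface of `c`. -/
noncomputable def classSize (g : Gluing) (c : Quotient (vtxSetoid g)) : ℕ :=
  Nat.card {v : OctVertex // Quotient.mk (vtxSetoid g) v = c}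

/-- The number of vertices of the quadrangulated link surface of the vertex class `c`:
the number of classes of edge-ends whose endpoint lies in `c`. -/
noncomputable def cornerCount (g : Gluing) (c : Quotient (vtxSetoid g)) : ℕ :=
  Nat.card {q : Quotient (endSetoid g) //
    ∃ p : EdgeEnd, Quotient.mk (endSetoid g) p = q ∧ Quotient.mk (vtxSetoid g) p.1.1 = c}

/-- The Euler characteristic of the link surface of the vertex class `c`: the link is
tiled by `classSize g c` quadrilaterals, with `2 * classSize g c` edges and
`cornerCount g c` vertices, so `χ = cornerCount - 2 * classSize + classSize`. -/
noncomputable def linkChi (g : Gluing) (c : Quotient (vtxSetoid g)) : ℤ :=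
  (cornerCount g c : ℤ) - (classSize g c : ℤ)

/-- All vertex links are 2-spheres: the quotient space is a closed manifold. -/
def AllLinksSphere (g : Gluing) : Prop := ∀ c, linkChi g c = 2

/-- The non-sphere vertex-link data consists of a single torus. -/
def LinksOneTorus (g : Gluing) : Prop :=
  (∀ c, linkChi g c = 2 ∨ linkChi g c = 0) ∧
    Nat.card {c : Quotient (vtxSetoid g) // linkChi g c = 0} = 1

/-- The non-sphere vertex-link data consists of two tori. -/
def LinksTwoTori (g : Gluing) : Prop :=
  (∀ c, linkChi g c = 2 ∨ linkChi g c = 0) ∧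
    Nat.card {c : Quotient (vtxSetoid g) // linkChi g c = 0} = 2

/-- The non-sphere vertex-link data consists of a single genus-2 surface. -/
def LinksGenusTwo (g : Gluing) : Prop :=
  (∀ c, linkChi g c = 2 ∨ linkChi g c = -2) ∧
    Nat.card {c : Quotient (vtxSetoid g) // linkChi g c = -2} = 1

/-- The non-sphere vertex-link data consists of one genus-2 surface and one torus. -/
def LinksGenusTwoTorus (g : Gluing) : Prop :=
  (∀ c, linkChi g c = 2 ∨ linkChi g c = 0 ∨ linkChi g c = -2) ∧
    Nat.card {c : Quotient (vtxSetoid g) // linkChi g c = 0} = 1 ∧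
    Nat.card {c : Quotient (vtxSetoid g) // linkChi g c = -2} = 1

/-- The non-sphere vertex-link data consists of a single genus-3 surface. -/
def LinksGenusThree (g : Gluing) : Prop :=
  (∀ c, linkChi g c = 2 ∨ linkChi g c = -4) ∧
    Nat.card {c : Quotient (vtxSetoid g) // linkChi g c = -4} = 1

/-! The geometric realization: the solid octahedron in `ℝ³` and the quotient
space `X(φ)` of a gluing pattern `φ`. -/

/-- The point `±e_i` of `ℝ³` corresponding to a vertex of the octahedron. -/
def vertexPt (v : OctVertex) : Fin 3 → ℝ :=
  fun j => if j = v.1 then (if v.2 then 1 else -1) else 0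

/-- The solid octahedron: the convex hull of `{±e₁, ±e₂, ±e₃}` in `ℝ³`. -/
def SolidOcta : Set (Fin 3 → ℝ) := convexHull ℝ (Set.range vertexPt)

theorem vertexPt_mem_solidOcta (v : OctVertex) : vertexPt v ∈ SolidOcta :=
  subset_convexHull ℝ _ (Set.mem_range_self v)

/-- The gluing relation on the solid octahedron: the point of the closed triangular face
of `F` with barycentric coordinates `w` is glued to the point of the face of
`face F` with the corresponding barycentric coordinates, i.e. the faces
are identified via the affine extensions of the combinatorial identifications. -/
def glueRel (g : Gluing) (x y : SolidOcta) : Prop :=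
  ∃ (F : OctFace) (w : Fin 3 → ℝ), (∀ i, 0 ≤ w i) ∧ (∑ i, w i) = 1 ∧
    (x : Fin 3 → ℝ) = ∑ i, w i • vertexPt (i, F i) ∧
    (y : Fin 3 → ℝ) = ∑ i, w i • vertexPt (g.axisMap F i, g.face F (g.axisMap F i))

/-- The equivalence relation on the solid octahedron generated by the affine face
identifications of a gluing pattern. -/
def glueSetoid (g : Gluing) : Setoid SolidOcta := Relation.EqvGen.setoid (glueRel g)

/-- The quotient space `X(φ)` of the solid octahedron by the gluing pattern `φ`,
with the quotient topology. -/
abbrev XSpace (g : Gluing) : Type := Quotient (glueSetoid g)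

namespace OctCount

/-! ### Numerical encodings -/

/-- index of a face, in `0..7` -/
def fi (F : OctFace) : ℕ := (F 0).toNat + 2 * (F 1).toNat + 4 * (F 2).toNat

/-- face with a given index -/
def unfi (n : ℕ) : OctFace := fun i => n.testBit i

/-- index of an axis permutation, in `0..5` -/
def pk (π : Equiv.Perm (Fin 3)) : ℕ := 2 * (π 0).val + (if π 1 < π 2 then 0 else 1)

/-- axis permutation with a given index -/
def unpk : ℕ → Equiv.Perm (Fin 3)
  | 0 => 1
  | 1 => Equiv.swap 1 2
  | 2 => Equiv.swap 0 1
  | 3 => Equiv.swap 0 1 * Equiv.swap 1 2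
  | 4 => Equiv.swap 1 2 * Equiv.swap 0 1
  | _ => Equiv.swap 0 2

/-- evaluate the argument first (helps the kernel) -/
def force {α : Type} (x : ℕ) (f : ℕ → α) : α := Nat.rec (f 0) (fun k _ => f (Nat.succ k)) x

theorem force_eq {α : Type} (x : ℕ) (f : ℕ → α) : force x f = f x := by
  cases x <;> rfl

/-- base 64 digit -/
def dig (c i : ℕ) : ℕ := Nat.mod (Nat.shiftRight c (Nat.mul 6 i)) 64

/-- base 8 digit -/
def dig8 (c i : ℕ) : ℕ := Nat.mod (Nat.shiftRight c (Nat.mul 3 i)) 8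

def actTerm (S T c i : ℕ) : ℕ :=
  Nat.shiftLeft (dig T (dig c i)) (Nat.mul 6 (dig8 S i))

/-- action of a symmetry given by tables on codes -/
def act (S T c : ℕ) : ℕ :=
  Nat.add (actTerm S T c 0) (Nat.add (actTerm S T c 1) (Nat.add (actTerm S T c 2)
    (Nat.add (actTerm S T c 3) (Nat.add (actTerm S T c 4) (Nat.add (actTerm S T c 5)
      (Nat.add (actTerm S T c 6) (actTerm S T c 7)))))))

/-- tables of the 48 symmetries: action on faces and on pairs (face, axis permutation) -/
def tabs : List (ℕ × ℕ) :=
  [(16434824, 9311821635039837955512368127886330548079973591624813520167021264505054541081692061351859309196672242890203471936),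
   (14570689, 8090281264385666186717875997832664615788297123814930197360206690803949657798331641749335548347035375610375217736),
   (11788826, 6868740893731477058790647747338787836614936675010051313103420829827283706914923298578029133262295386065703085136),
   (9924691, 5647200523077305289996155617285121904323260207200167990296606256126178823631562878975505372412658518785874830936),
   (6852524, 4425660152423116162068927366667901068502441573021996760156910815051354605984416220519667173371307793756923504736),
   (4988389, 3204119781768944393274435236614235136210765105212113437350096241350249722701055800917143412521670926477095250536),
   (2206526, 1982579411114755265347206986120358357037404656407234553093310380373583771817647457745836997436930936932423117936),
   (342391, 761039040460583496552714856066692424745728188597351230286495806672478888534287038143313236587294069652594863736),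
   (16362248, 8858591332666304366030022964585221989083349692394813590981878263871966022803148006968442651993228670846452650048),
   (14498113, 7637050962012132597235530834531556056791673224584930268175063690170861139519787587365918891143591803566624395848),
   (7070252, 3972429850049582572586582203490136566153275859165289176854677394516424354469610481420782300124474957197451876448),
   (5206117, 2750889479395410803792090073436470633861599391355405854047862820815319471186250061818258539274838089917623622248),
   (11571098, 6415510591357943469308302583976007249294583683093405210976823039145116055254510086552346584080546446279812666448),
   (9706963, 5193970220703771700513810453922341317002907215283521888170008465444011171971149666949822823230909578999984412248),
   (2279102, 1529349108741221675864861822880921826364509849863880796849622169789574386920972561004686232211792732630811892848),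
   (414967, 307808738087049907070369692827255894072833382053997474042807596088469503637612141402162471362155865350983638648),
   (16205392, 8708282923080728047950403063704992423820044232584707962443794754196247448053103261834744629960816438990154506560),
   (12477122, 6265202181772384510361418803597660559236691296964941316830165606794037681486382422629697108261542704430497998160),
   (13882393, 7486742552426547599589542873431221068087525774277326858911994536857362030969718880447829541993628010577904313160),
   (10154123, 5043661811118204062000558613323889203504172838657560213298365389455152264402998041242782020294354276018247804760),
   (6623092, 3822121440464006254506962302486562944242512213981891202433684304742547512955827421002552494135451989856874539360),
   (2894822, 1379040699155662716917978042379231079659159278362124556820055157340337746389106581797504972436178255297218030960),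
   (4300093, 2600581069809825806146102112212791588509993755674510098901884087403662095872443039615637406168263561444624345960),
   (571823, 157500328501482268557117852105459723926640820054743453288254940001452329305722200410589884468989826884967837560),
   (16096528, 8860900921608517911309206627444256972906956368672354213463646590941028862379309988028059053320307226886393303360),
   (12368258, 6417820180300174373720222367336925108323603433052587567850017443538819095812589148823011531621033492326736794960),
   (6804532, 3974739438991796117865765866349171549976882535442829799336445721585487194045772462480398701451553513237392529760),
   (3076262, 1531658697683452580276781606241839685393529599823063153722816574183277427479051623275351179752279778677736021360),
   (13700953, 7639360550954337462948346437139649603012573364021650023461118978577603878604991027820011019363966114603073311560),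
   (9972683, 5196279809645993925359362177032317738429220428401883377847489831175394112038270188614963497664692380043416803160),
   (4408957, 2753199068337615669504905676044564180082499530792125609333918109222062210271453502272350667495212400954072537960),
   (680687, 310118327029272131915921415937232315499146595172358963720288961819852443704732663067303145795938666394416029560),
   (15673952, 8710596462932662455107066570791169479633689311901487627718849615190455604008603051956099542282236668899266154624),
   (8217412, 3824434980315975379929098050576505750466983440661954336491591320386036070875161373546004498883689199779953137824),
   (13350953, 7489056092278482006746206380517398123901170853594106524187049397851570186925218670569184454315048240487015961224),
   (5894413, 2602894609661794931568237860302734394734464982354573232959791103047150653791776992159089410916500771367702944424),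
   (10882802, 6267515721624301558385346190181954739844923302600079247713794390463605636459965131540003474369554444332626171024),
   (3426262, 1381354239007614483207377669967291010678217431360545956486536095659186103326523453129908430971006975213313154224),
   (8559803, 5045975350970121110024485999908183384112404844292698144181994173124720219376580750153088386402366015920375977624),
   (1103263, 159813868353434034846517479693519654945698973053164852954735878320300686243139071742993343003818546801062960824),
   (15637664, 9309509224019231907057117005702117838485674076337310108728724679213990524363029370963693899122118199435481583744),
   (8181124, 4423347741402544831879148485487454109318968205097776817501466384409570991229587692553598855723570730316168566944),
   (10991666, 6866428482710871010335396625154575127020637159722547901665124244536219690196260608189863723187741342610981196944),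
   (3535126, 1980267000094183935157428104939911397853931288483014610437865949731800157062818929779768679789193873491668180144),
   (13242089, 8087968853365051458696256815397510468591291071686605918726197066850565540588710410755645865165777087152161591944),
   (5785549, 3201807370748364383518288295182846739424585200447072627498938772046146007455268732345550821767229618032848575144),
   (8596091, 5644888112056690561974536434849967757126254155071843711662596632172794706421941647981815689231400230327661205144),
   (1139551, 758726629440003486796567914635304027959548283832310420435338337368375173288499969571720645832852761208348188344)]

/-- Codes of the canonical gluing patterns (smallest in their orbit), all links spheres. -/
def reps0 : List ℕ :=
  [106687673597960, 106690961932555, 106687673598156, 106690961932492, 46208221974160, 45802215444112,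
   46208221986452, 106661232708128, 106871686122208, 106870612380448, 106661283039780, 45769634229930,
   44152939187890, 1134544750136, 1134545798904, 1134545536824, 567346891832, 567398272056,
   14328684283452, 14328685332220, 14333030631164, 14331973666556, 14607908550396, 14539189077756,
   14538132113148, 14328685070140, 14331973404476, 14538131851068, 14324952664188, 14599830583420,
   14531111110780, 15402562325052, 15402563385916, 15402563127868, 14040710692092, 13985088900412,
   13988377234748]

/-- Codes of the canonical gluing patterns (smallest in their orbit), one torus. -/
def reps1 : List ℕ :=
  [106897120378888, 106893832044811, 106898177343755, 106897120379147, 106893832044748, 106898177343692,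
   106897120379084, 45802215460499, 45802215456404, 40716961517145, 40721306816089, 40720249851481,
   45115008028313, 45119353327257, 45118296362649, 40716961779290, 40716962565725, 40991840484957,
   40923121012317, 45115009076893, 45389886996125, 45321167523485, 40708784721504, 40709858725472,
   40713080737376, 45107905236640, 45111127248544, 106664521042723, 45314130792099, 106664504265508,
   45107955568292, 45314114014884, 41371587718762, 45700914491050, 39686173199985, 39689462595185,
   39686174002801, 39689462337137, 39754892676722, 44152939990706, 44146134494898, 44359097618101,
   1127607896248, 1402485815480, 1333766342840, 584790936632, 588080331832, 584791739448,
   588080073784, 576895458360, 790949367096, 795294666040, 794237701432, 790950427960,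
   795295726904, 794238762296, 790950169912, 795295468856, 794238504248, 783053888824,
   14321747429564, 14596625348796, 14527905876156, 14320723757436, 14595601676668, 14526882204028,
   14989734320700, 14921031363132, 14989751102012, 14994046069500, 14992972327740, 14053808377084,
   14053809437948, 14058154736892, 14057097772284, 14053809179900, 14057097514236, 14047054028028,
   13988378295612, 13985089703228, 13988378037564]

/-- Codes of the canonical gluing patterns (smallest in their orbit), two tori. -/
def reps2 : List ℕ :=
  [40708835053156, 41301777456745, 39678277721713, 39678294503025, 39747013979762, 39747064323698,
   44352343269045, 1126517115000, 577986243640]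

/-- Codes of the canonical gluing patterns (smallest in their orbit), one genus-2 link. -/
def reps3 : List ℕ :=
  [46414447529619, 45805503794835, 46414447525524, 45806560755348, 45805503790740, 40991839436377,
   40923119963737, 40721307078234, 40720250113626, 40721307864669, 40720250900061, 40996185783901,
   40995128819293, 40927466311261, 40926409346653, 45119354375837, 45118297411229, 45394232295069,
   45393175330461, 45325512822429, 45324455857821, 120065893812963, 106870679489315, 120064820071203,
   40709925834339, 40713147846243, 45111194357411, 120134596508388, 106871736453860, 106870662712100,
   120064803293988, 40709909057124, 40713131069028, 45111177580196, 45699891093161, 41302851198570,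
   41302867979882, 41302918323818, 45700964834986, 41306072424045, 41374808944237, 39679368506993,
   39679418850929, 39754893737586, 39754893479538, 39748071202418, 39751293214322, 39748087983730,
   39751309995634, 39748138327666, 39751360339570, 44146184838834, 44149406850738, 44359098678965,
   44363443977909, 44362387013301, 44359098420917, 44362386755253, 44355514937013, 1138891097848,
   1137834133240, 1413769017080, 1345049544440, 1343992579832, 1137833871160, 1343992317752,
   1127591118968, 1130813130872, 1405691050104, 1336971577464, 1126533892280, 1126584224120,
   1401462143352, 1332742670712, 576912239672, 578036587576, 570636028984, 570619513912,
   787366686008, 784195018040, 776794459448, 776777944376, 14320656648316, 14321730652284,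
   14595534567548, 14596608571516, 14526815094908, 14527889098876, 14320673425596, 14595551344828,
   14526831872188, 14921014581820, 15195893537340, 14921081707068, 15406858353404, 15681786591996,
   15613083892476, 15200188504828, 14925376674556, 15405784611644, 15612010150716, 15405784353596,
   15612009892668, 15199114763068, 14924302932796, 14045912898812, 14050225695996, 13977193422140,
   13977210203452, 13978284207420, 13978334551356, 13970933992764, 13970917477692]

/-- Codes of the canonical gluing patterns (smallest in their orbit), a genus-2 and a torus link. -/
def reps4 : List ℕ :=
  [40915010276963, 40914993499748]

/-- Codes of the canonical gluing patterns (smallest in their orbit), one genus-3 link. -/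
def reps5 : List ℕ :=
  [120159980433675, 120091260961035, 120161037398220, 120091260960972, 40996184735321, 40995127770713,
   40927465262681, 40926408298073, 46850879401625, 45394231246489, 45325511773849, 45324454809241,
   40996184997466, 40927465524826, 40926408560218, 40916084280931, 40919306292835, 45317352804003,
   40984786976356, 40988008988260, 40916067503716, 40919289515620, 45386055499428, 45317336026788,
   41301794238057, 41301844581993, 45699840749225, 41371570937450, 41371638062698, 41374792162925,
   41580951379565, 41306089205357, 41306139549293, 39759239036530, 39758182071922, 39758181813874,
   44156228583090, 44156228325042, 1401395034232, 1402469038200, 1332675561592, 1333749565560,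
   1401411811512, 1332692338872, 783070670136, 784144674104, 783121014072, 14925309549308,
   14994029288188, 14925326330620, 14924235807548, 14992955546428, 14924252588860, 14045929680124,
   14047003684092, 14045980024060]

def reps : List ℕ := reps0 ++ (reps1 ++ (reps2 ++ (reps3 ++ (reps4 ++ reps5))))

def memB (c : ℕ) : List ℕ → Bool
  | [] => false
  | a :: l => cond (Nat.beq c a) true (memB c l)

def allS : (ℕ × ℕ → Bool) → List (ℕ × ℕ) → Bool
  | _, [] => true
  | Q, a :: l => cond (Q a) (allS Q l) false

def canonB (c : ℕ) : Bool := allS (fun st => Nat.ble c (act st.1 st.2 c)) tabs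

def leaf (c : ℕ) : Bool := force c fun c => cond (canonB c) (memB c reps) true

def parity (n : ℕ) : Bool := Bool.xor (n.testBit 0) (Bool.xor (n.testBit 1) (n.testBit 2))

def permsFor (a b : ℕ) : List ℕ := cond (parity a == parity b) [1, 2, 5] [0, 3, 4]

def invT : ℕ → ℕ
  | 3 => 4
  | 4 => 3
  | k => k

def term (a b p : ℕ) : ℕ := (8 * b + p) * 64 ^ a + (8 * a + invT p) * 64 ^ b

def enumAll (Q : ℕ → Bool) : ℕ → List ℕ → ℕ → Bool
  | 0, _, acc => Q acc
  | _ + 1, [], acc => Q acc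
  | n + 1, a :: rest, acc =>
    rest.all fun b => (permsFor a b).all fun p =>
      enumAll Q n (rest.filter fun x => !(Nat.beq x b)) (acc + term a b p)

/-! ### Links -/

def permT (k i : ℕ) : ℕ := Nat.mod (Nat.shiftRight 6746936868 (Nat.mul 2 (Nat.add (Nat.mul 3 k) i))) 4

def fv (f i : ℕ) : ℕ := Nat.add (Nat.mul 2 i) (Nat.mod (Nat.shiftRight f i) 2)

def tv (d i : ℕ) : ℕ := 
  force (permT (Nat.mod d 8) i) fun p =>
    Nat.add (Nat.mul 2 p) (Nat.mod (Nat.shiftRight (Nat.div d 8) p) 2)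

def pairsV (c : ℕ) : List (ℕ × ℕ) :=
  [0, 1, 2, 3, 4, 5, 6, 7].flatMap fun f => [0, 1, 2].map fun i => (fv f i, tv (dig c f) i)

def pairsE (c : ℕ) : List (ℕ × ℕ) :=
  [0, 1, 2, 3, 4, 5, 6, 7].flatMap fun f =>
    [(0, 1), (0, 2), (1, 0), (1, 2), (2, 0), (2, 1)].map fun ij =>
      (Nat.add (Nat.mul 6 (fv f ij.1)) (fv f ij.2),
        Nat.add (Nat.mul 6 (tv (dig c f) ij.1)) (tv (dig c f) ij.2))

def nth (L : List ℕ) : ℕ → ℕ :=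
  List.rec (fun _ => 0) (fun a _ ih n => Nat.rec a (fun k _ => ih k) n) L

/-- recolor, in continuation passing style so that the kernel evaluates eagerly -/
def recolor {α : Type} (x y : ℕ) (L : List ℕ) : (List ℕ → α) → α :=
  List.rec (fun k => k []) (fun a _ ih k =>
    Bool.rec (ih fun r => k (a :: r)) (ih fun r => k (y :: r)) (Nat.beq a x)) L

def merge {α : Type} (L : List ℕ) (a b : ℕ) (k : List ℕ → α) : α :=
  force (nth L a) fun x => force (nth L b) fun y => cond (Nat.beq x y) (k L) (recolor x y L k)

def uf {α : Type} (ps : List (ℕ × ℕ)) : List ℕ → (List ℕ → α) → α :=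
  List.rec (fun L k => k L) (fun p _ ih L k => merge L p.1 p.2 fun M => ih M k) ps

def idxV : List ℕ := [0, 1, 2, 3, 4, 5]
def idxE : List ℕ := [2, 3, 4, 5, 8, 9, 10, 11, 12, 13, 16, 17, 18, 19, 22, 23,
  24, 25, 26, 27, 30, 31, 32, 33]
def idx36 : List ℕ := [0, 1, 2, 3, 4, 5, 6, 7, 8, 9, 10, 11, 12, 13, 14, 15, 16, 17,
  18, 19, 20, 21, 22, 23, 24, 25, 26, 27, 28, 29, 30, 31, 32, 33, 34, 35]

def countN (p : ℕ → Bool) (l : List ℕ) : ℕ :=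
  List.rec 0 (fun a _ ih => Bool.rec ih (Nat.succ ih) (p a)) l

def sizeN (LV : List ℕ) (x : ℕ) : ℕ := countN (fun w => Nat.beq (nth LV w) x) idxV

def cornerN (LV LE : List ℕ) (x : ℕ) : ℕ :=
  countN (fun e => cond (Nat.beq (nth LE e) e) (Nat.beq (nth LV (Nat.div e 6)) x) false) idxE

/-- Euler characteristic plus 6 of the link of the vertex with index `v` -/
def chiN (LV LE : List ℕ) (v : ℕ) : ℕ :=
  force (nth LV v) fun x => Nat.sub (Nat.add (cornerN LV LE x) 6) (sizeN LV x)

/-- evaluated map -/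
def mapK {α : Type} (f : ℕ → ℕ) : List ℕ → (List ℕ → α) → α
  | [], k => k []
  | a :: l, k => force (f a) fun b => mapK f l fun r => k (b :: r)

/-- vertex labels and shifted Euler characteristics for the code `c` -/
def withChi {α : Type} (c : ℕ) (k : List ℕ → List ℕ → α) : α :=
  uf (pairsV c) idxV fun LV => uf (pairsE c) idx36 fun LE =>
    mapK (chiN LV LE) idxV fun X => k LV X

/-- number of vertex classes with Euler characteristic `k - 6` -/
def numChi (LV X : List ℕ) (k : ℕ) : ℕ :=
  countN (fun v => cond (Nat.beq (nth LV v) v) (Nat.beq (nth X v) k) false) idxV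

def allChi (X : List ℕ) (p : ℕ → Bool) : Bool := idxV.all fun v => p (nth X v)

def T0 (_LV X : List ℕ) : Bool := allChi X fun x => Nat.beq x 8
def T1 (LV X : List ℕ) : Bool :=
  (allChi X fun x => Nat.beq x 8 || Nat.beq x 6) && Nat.beq (numChi LV X 6) 1
def T2 (LV X : List ℕ) : Bool :=
  (allChi X fun x => Nat.beq x 8 || Nat.beq x 6) && Nat.beq (numChi LV X 6) 2
def T3 (LV X : List ℕ) : Bool :=
  (allChi X fun x => Nat.beq x 8 || Nat.beq x 4) && Nat.beq (numChi LV X 4) 1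
def T4 (LV X : List ℕ) : Bool :=
  (allChi X fun x => Nat.beq x 8 || (Nat.beq x 6 || Nat.beq x 4)) &&
    (Nat.beq (numChi LV X 6) 1 && Nat.beq (numChi LV X 4) 1)
def T5 (LV X : List ℕ) : Bool :=
  (allChi X fun x => Nat.beq x 8 || Nat.beq x 2) && Nat.beq (numChi LV X 2) 1

def typ (T : List ℕ → List ℕ → Bool) (c : ℕ) : Bool := withChi c T

/-- exactly the `i`-th of the six link types holds -/
def bitsIs (i : ℕ) (LV X : List ℕ) : Bool :=
  (T0 LV X == Nat.beq i 0) && ((T1 LV X == Nat.beq i 1) && ((T2 LV X == Nat.beq i 2) &&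
    ((T3 LV X == Nat.beq i 3) && ((T4 LV X == Nat.beq i 4) && (T5 LV X == Nat.beq i 5)))))

/-- the code satisfies the numerical form of the gluing conditions -/
def validB (c : ℕ) : Bool :=
  ([0, 1, 2, 3, 4, 5, 6, 7].all fun i =>
    memB (Nat.mod (dig c i) 8) (permsFor i (Nat.div (dig c i) 8)) &&
    (Nat.beq (dig c (Nat.div (dig c i) 8)) (8 * i + invT (Nat.mod (dig c i) 8)) &&
    !(Nat.beq (Nat.div (dig c i) 8) i))) && Nat.blt c (64 ^ 8)

theorem enum_check : enumAll leaf 4 [0, 1, 2, 3, 4, 5, 6, 7] 0 = true := by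
  decide +kernel

theorem canon_check : reps.all canonB = true := by decide +kernel
theorem valid_check : reps.all validB = true := by decide +kernel
theorem nodup_check : reps.Nodup := by decide +kernel

theorem chk0 : reps0.all (typ (bitsIs 0)) = true := by decide +kernel
theorem chk1 : reps1.all (typ (bitsIs 1)) = true := by decide +kernel
theorem chk2 : reps2.all (typ (bitsIs 2)) = true := by decide +kernel
theorem chk3 : reps3.all (typ (bitsIs 3)) = true := by decide +kernel
theorem chk4 : reps4.all (typ (bitsIs 4)) = true := by decide +kernel
theorem chk5 : reps5.all (typ (bitsIs 5)) = true := by decide +kernel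

/-! ### Encoding of gluings -/

theorem fi_lt : ∀ F : OctFace, fi F < 8 := by decide +kernel
theorem fi_unfi : ∀ n < 8, fi (unfi n) = n := by decide +kernel
theorem unfi_fi : ∀ F : OctFace, unfi (fi F) = F := by decide +kernel
theorem pk_lt : ∀ π : Equiv.Perm (Fin 3), pk π < 6 := by decide +kernel
theorem pk_unpk : ∀ n < 6, pk (unpk n) = n := by decide +kernel
theorem unpk_pk : ∀ π : Equiv.Perm (Fin 3), unpk (pk π) = π := by decide +kernel
theorem pk_inv : ∀ π : Equiv.Perm (Fin 3), pk π⁻¹ = invT (pk π) := by decide +kernel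
theorem parity_fi : ∀ F : OctFace, parity (fi F) = faceSign F := by decide +kernel
theorem sign_pk : ∀ π : Equiv.Perm (Fin 3),
    (Equiv.Perm.sign π = 1 ∧ pk π ∈ [0, 3, 4] ∧ pk π ∉ [1, 2, 5]) ∨
    (Equiv.Perm.sign π ≠ 1 ∧ pk π ∈ [1, 2, 5] ∧ pk π ∉ [0, 3, 4]) := by decide +kernel

theorem fi_inj {F G : OctFace} (h : fi F = fi G) : F = G := by
  rw [← unfi_fi F, h, unfi_fi]

theorem pk_inj {F G : Equiv.Perm (Fin 3)} (h : pk F = pk G) : F = G := by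
  rw [← unpk_pk F, h, unpk_pk]

theorem permsFor_iff (F G : OctFace) (π : Equiv.Perm (Fin 3)) :
    pk π ∈ permsFor (fi F) (fi G) ↔ (Equiv.Perm.sign π = 1 ↔ faceSign F ≠ faceSign G) := by
  unfold permsFor
  rw [parity_fi, parity_fi]
  by_cases hp : faceSign F = faceSign G
  · simp only [hp, BEq.rfl, cond_true, ne_eq, not_true, iff_false]
    rcases sign_pk π with h | h
    · exact iff_of_false h.2.2 (fun h' => h' h.1)
    · exact iff_of_true h.2.1 h.1
  · have : (faceSign F == faceSign G) = false := by simpa using hp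
    rw [this]
    simp only [cond_false, ne_eq, hp, not_false_iff, iff_true]
    rcases sign_pk π with h | h
    · exact iff_of_true h.2.1 h.1
    · exact iff_of_false h.2.2 h.1

/-- faces are numbered by `Fin 8` -/
def faceEquiv : Fin 8 ≃ OctFace where
  toFun n := unfi n
  invFun F := ⟨fi F, fi_lt F⟩
  left_inv n := Fin.ext (fi_unfi n n.2)
  right_inv F := unfi_fi F

theorem sumFace (h : OctFace → ℕ) : ∑ F, h F = h (unfi 0) + h (unfi 1) + h (unfi 2) +
    h (unfi 3) + h (unfi 4) + h (unfi 5) + h (unfi 6) + h (unfi 7) := by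
  rw [← faceEquiv.sum_comp, Fin.sum_univ_eight]
  rfl

/-- value of a gluing on a face, as a number below 64 -/
def val (g : Gluing) (F : OctFace) : ℕ := 8 * fi (g.face F) + pk (g.axisMap F)

theorem val_lt (g : Gluing) (F : OctFace) : val g F < 64 := by
  have := fi_lt (g.face F)
  have := pk_lt (g.axisMap F)
  unfold val; omega

/-- code of a gluing -/
def enc (g : Gluing) : ℕ := ∑ F, val g F * 64 ^ fi F

theorem dig_eq (c i : ℕ) : dig c i = c / 64 ^ i % 64 := by
  have h : (64 : ℕ) ^ i = 2 ^ (6 * i) := by rw [pow_mul]; norm_num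
  rw [h, ← Nat.shiftRight_eq_div_pow]
  rfl

theorem dig8_eq (c i : ℕ) : dig8 c i = c / 8 ^ i % 8 := by
  have h : (8 : ℕ) ^ i = 2 ^ (3 * i) := by rw [pow_mul]; norm_num
  rw [h, ← Nat.shiftRight_eq_div_pow]
  rfl

theorem digits_sum (a : ℕ → ℕ) (ha : ∀ i, a i < 64) (j : ℕ) (hj : j < 8) :
    dig (a 0 * 64 ^ 0 + a 1 * 64 ^ 1 + a 2 * 64 ^ 2 + a 3 * 64 ^ 3 + a 4 * 64 ^ 4 + a 5 * 64 ^ 5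
      + a 6 * 64 ^ 6 + a 7 * 64 ^ 7) j = a j := by
  rw [dig_eq]
  have h0 := ha 0
  have h1 := ha 1
  have h2 := ha 2
  have h3 := ha 3
  have h4 := ha 4
  have h5 := ha 5
  have h6 := ha 6
  have h7 := ha 7
  interval_cases j <;> norm_num <;> omega

theorem enc_eq (g : Gluing) : enc g = val g (unfi 0) * 64 ^ 0 + val g (unfi 1) * 64 ^ 1 +
    val g (unfi 2) * 64 ^ 2 + val g (unfi 3) * 64 ^ 3 + val g (unfi 4) * 64 ^ 4 +
    val g (unfi 5) * 64 ^ 5 + val g (unfi 6) * 64 ^ 6 + val g (unfi 7) * 64 ^ 7 := by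
  unfold enc
  rw [sumFace, fi_unfi 0 (by norm_num), fi_unfi 1 (by norm_num), fi_unfi 2 (by norm_num),
    fi_unfi 3 (by norm_num), fi_unfi 4 (by norm_num), fi_unfi 5 (by norm_num),
    fi_unfi 6 (by norm_num), fi_unfi 7 (by norm_num)]

theorem dig_enc' (g : Gluing) (j : ℕ) (hj : j < 8) : dig (enc g) j = val g (unfi j) := by
  rw [enc_eq]
  exact digits_sum (fun i => val g (unfi i)) (fun i => val_lt g _) j hj

theorem dig_enc (g : Gluing) (F : OctFace) : dig (enc g) (fi F) = val g F := by
  rw [dig_enc' g _ (fi_lt F), unfi_fi]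

theorem enc_inj {g h : Gluing} (e : enc g = enc h) : g = h := by
  have hv : ∀ F, val g F = val h F := fun F => by rw [← dig_enc, e, dig_enc]
  have h1 : ∀ F, g.face F = h.face F ∧ g.axisMap F = h.axisMap F := by
    intro F
    have h0 := hv F
    unfold val at h0
    have a1 := pk_lt (g.axisMap F)
    have a2 := pk_lt (h.axisMap F)
    exact ⟨fi_inj (by omega), pk_inj (by omega)⟩
  apply Subtype.ext
  apply Prod.ext
  · exact Equiv.ext fun F => (h1 F).1
  · exact funext fun F => (h1 F).2

/-! ### Symmetries -/

theorem pinv_apply_self {α : Type} (e : Equiv.Perm α) (x : α) : e⁻¹ (e x) = x :=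
  e.symm_apply_apply x

theorem papply_inv_self {α : Type} (e : Equiv.Perm α) (x : α) : e (e⁻¹ x) = x :=
  e.apply_symm_apply x


def tab (ρ : Equiv.Perm (Fin 3)) (ε : OctFace) : ℕ × ℕ := tabs.getD (8 * pk ρ + fi ε) (0, 0)

theorem tabS : ∀ (ρ : Equiv.Perm (Fin 3)) (ε F : OctFace),
    dig8 (tab ρ ε).1 (fi F) = fi (symMapFace ρ ε F) := by decide +kernel

theorem conjT : ∀ (ρ π : Equiv.Perm (Fin 3)) , 
    Nat.mod (dig (tab ρ (unfi 0)).2 (pk π)) 8 = pk (ρ * π * ρ⁻¹) := by decide +kernel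

theorem tabT_num : ∀ k < 6, ∀ e < 8, ∀ a < 8, ∀ b < 6,
    dig (tabs.getD (8 * k + e) (0, 0)).2 (8 * a + b) = 
      8 * dig8 (tabs.getD (8 * k + e) (0, 0)).1 a + 
        Nat.mod (dig (tabs.getD (8 * k + 0) (0, 0)).2 b) 8 := by decide +kernel

theorem tabT (ρ : Equiv.Perm (Fin 3)) (ε G : OctFace) (π : Equiv.Perm (Fin 3)) :
    dig (tab ρ ε).2 (8 * fi G + pk π) = 8 * fi (symMapFace ρ ε G) + pk (ρ * π * ρ⁻¹) := by
  rw [← conjT, ← tabS]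
  exact tabT_num _ (pk_lt ρ) _ (fi_lt ε) _ (fi_lt G) _ (pk_lt π)

theorem tab_mem (ρ : Equiv.Perm (Fin 3)) (ε : OctFace) : tab ρ ε ∈ tabs := by
  have h : 8 * pk ρ + fi ε < tabs.length := by
    have := pk_lt ρ
    have := fi_lt ε
    have h48 : tabs.length = 48 := rfl
    omega
  unfold tab
  rw [List.getD_eq_getElem _ _ h]
  exact List.getElem_mem h

theorem mem_tab {st : ℕ × ℕ} (h : st ∈ tabs) : ∃ ρ ε, st = tab ρ ε := by
  obtain ⟨n, hn, rfl⟩ := List.mem_iff_getElem.1 h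
  have h48 : tabs.length = 48 := rfl
  refine ⟨unpk (n / 8), unfi (n % 8), ?_⟩
  unfold tab
  rw [pk_unpk _ (by omega), fi_unfi _ (by omega), Nat.div_add_mod, List.getD_eq_getElem _ _ hn]

theorem symMapFace_inv (ρ : Equiv.Perm (Fin 3)) (ε F : OctFace) :
    symMapFace ρ⁻¹ (fun j => ε (ρ⁻¹ j)) (symMapFace ρ ε F) = F := by
  funext j
  simp [symMapFace]

theorem symMapFace_inv' (ρ : Equiv.Perm (Fin 3)) (ε F : OctFace) :
    symMapFace ρ ε (symMapFace ρ⁻¹ (fun j => ε (ρ⁻¹ j)) F) = F := by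
  funext j
  simp [symMapFace]

/-- symmetry of the octahedron acting on faces, as a permutation -/
def symE (ρ : Equiv.Perm (Fin 3)) (ε : OctFace) : Equiv.Perm OctFace where
  toFun := symMapFace ρ ε
  invFun := symMapFace ρ⁻¹ (fun j => ε (ρ⁻¹ j))
  left_inv := symMapFace_inv ρ ε
  right_inv := symMapFace_inv' ρ ε

theorem faceSign_sym : ∀ (ρ : Equiv.Perm (Fin 3)) (ε F : OctFace),
    faceSign (symMapFace ρ ε F) = Bool.xor (faceSign F) (faceSign ε) := by decide +kernel

/-- The transform of a gluing by a symmetry. -/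
def symGl (ρ : Equiv.Perm (Fin 3)) (ε : OctFace) (g : Gluing) : Gluing :=
  ⟨(symE ρ ε * g.face * (symE ρ ε)⁻¹, fun F => ρ * g.axisMap ((symE ρ ε)⁻¹ F) * ρ⁻¹), by
    obtain ⟨h1, h2, h3, h4⟩ := g.2
    refine ⟨fun F => ?_, fun F => ?_, fun F => ?_, fun F => ?_⟩
    · have := h1 ((symE ρ ε)⁻¹ F)
      simp only [Equiv.Perm.mul_apply, pinv_apply_self]
      change symE ρ ε (g.1.1 (g.1.1 ((symE ρ ε)⁻¹ F))) = F
      rw [this, papply_inv_self]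
    · intro h
      apply h2 ((symE ρ ε)⁻¹ F)
      apply (symE ρ ε).injective
      rw [papply_inv_self]
      exact h
    · simp only [Equiv.Perm.mul_apply, pinv_apply_self]
      have := h3 ((symE ρ ε)⁻¹ F)
      change ρ * g.1.2 (g.1.1 ((symE ρ ε)⁻¹ F)) * ρ⁻¹ = (ρ * g.1.2 ((symE ρ ε)⁻¹ F) * ρ⁻¹)⁻¹
      rw [this]
      group
    · obtain ⟨G, rfl⟩ := (symE ρ ε).surjective F
      have := h4 G
      simp only [Equiv.Perm.mul_apply, pinv_apply_self]
      change Equiv.Perm.sign (ρ * g.1.2 G * ρ⁻¹) = 1 ↔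
        faceSign (symMapFace ρ ε G) ≠ faceSign (symMapFace ρ ε (g.1.1 G))
      rw [faceSign_sym, faceSign_sym, Equiv.Perm.sign_mul, Equiv.Perm.sign_mul,
        Equiv.Perm.sign_inv, mul_right_comm, Int.units_mul_self, one_mul, this]
      simp⟩

theorem symGl_face (ρ ε) (g : Gluing) (F : OctFace) :
    (symGl ρ ε g).face (symMapFace ρ ε F) = symMapFace ρ ε (g.face F) := by
  change symE ρ ε (g.face ((symE ρ ε)⁻¹ (symE ρ ε F))) = _
  rw [pinv_apply_self]; rfl

theorem symGl_axis (ρ ε) (g : Gluing) (F : OctFace) :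
    (symGl ρ ε g).axisMap (symMapFace ρ ε F) = ρ * g.axisMap F * ρ⁻¹ := by
  change ρ * (g.axisMap ((symE ρ ε)⁻¹ (symE ρ ε F))) * ρ⁻¹ = _
  rw [pinv_apply_self]

theorem symGl_equiv (ρ ε) (g : Gluing) : EquivGluing g (symGl ρ ε g) :=
  ⟨ρ, ε, symGl_face ρ ε g, symGl_axis ρ ε g⟩

theorem equiv_refl (g : Gluing) : EquivGluing g g := by
  have h : ∀ F, symMapFace 1 (fun _ => false) F = F := by
    intro F; funext j; simp [symMapFace]
  refine ⟨1, fun _ => false, fun F => ?_, fun F => ?_⟩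
  · rw [h, h]
  · rw [h]; simp

theorem equiv_symm {g h : Gluing} (e : EquivGluing g h) : EquivGluing h g := by
  obtain ⟨ρ, ε, h1, h2⟩ := e
  refine ⟨ρ⁻¹, fun j => ε (ρ⁻¹ j), fun F => ?_, fun F => ?_⟩
  · obtain ⟨G, rfl⟩ := (symE ρ ε).surjective F
    change g.face (symMapFace ρ⁻¹ _ (symMapFace ρ ε G)) =
      symMapFace ρ⁻¹ _ (h.face (symMapFace ρ ε G))
    rw [h1, symMapFace_inv, symMapFace_inv]
  · obtain ⟨G, rfl⟩ := (symE ρ ε).surjective F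
    change g.axisMap (symMapFace ρ⁻¹ _ (symMapFace ρ ε G)) =
      ρ⁻¹ * (h.axisMap (symMapFace ρ ε G)) * ρ⁻¹⁻¹
    rw [h2, symMapFace_inv]
    group

theorem equiv_trans {g h k : Gluing} (e : EquivGluing g h) (e' : EquivGluing h k) :
    EquivGluing g k := by
  obtain ⟨ρ, ε, h1, h2⟩ := e
  obtain ⟨ρ', ε', h1', h2'⟩ := e'
  have hc : ∀ F, symMapFace (ρ' * ρ) (fun j => Bool.xor (ε j) (ε' (ρ j))) F =
      symMapFace ρ' ε' (symMapFace ρ ε F) := by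
    intro F; funext j; simp [symMapFace]
  refine ⟨ρ' * ρ, fun j => Bool.xor (ε j) (ε' (ρ j)), fun F => ?_, fun F => ?_⟩
  · rw [hc, hc, h1', h1]
  · rw [hc, h2', h2]; group

theorem orbit_eq_iff {g h : Gluing} : orbit g = orbit h ↔ EquivGluing g h := by
  constructor
  · intro e
    have : h ∈ orbit g := by rw [e]; exact equiv_refl h
    exact this
  · intro e
    ext k
    exact ⟨fun hk => equiv_trans (equiv_symm e) hk, fun hk => equiv_trans e hk⟩

theorem actTerm_eq (S T c i : ℕ) : actTerm S T c i = dig T (dig c i) * 64 ^ dig8 S i := by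
  have h : (64 : ℕ) ^ dig8 S i = 2 ^ (6 * dig8 S i) := by rw [pow_mul]; norm_num
  rw [h, ← Nat.shiftLeft_eq]
  rfl

theorem act_eq (S T c : ℕ) : act S T c = ∑ F : OctFace, actTerm S T c (fi F) := by
  rw [sumFace, fi_unfi 0 (by norm_num), fi_unfi 1 (by norm_num), fi_unfi 2 (by norm_num),
    fi_unfi 3 (by norm_num), fi_unfi 4 (by norm_num), fi_unfi 5 (by norm_num),
    fi_unfi 6 (by norm_num), fi_unfi 7 (by norm_num)]
  unfold act
  simp only [Nat.add_eq]
  ring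

theorem act_enc {g h : Gluing} {ρ ε} 
    (h1 : ∀ F, h.face (symMapFace ρ ε F) = symMapFace ρ ε (g.face F))
    (h2 : ∀ F, h.axisMap (symMapFace ρ ε F) = ρ * g.axisMap F * ρ⁻¹) :
    act (tab ρ ε).1 (tab ρ ε).2 (enc g) = enc h := by
  rw [act_eq]
  rw [show enc h = ∑ F, val h F * 64 ^ fi F from rfl,
    ← Equiv.sum_comp (symE ρ ε) fun F => val h F * 64 ^ fi F]
  refine Finset.sum_congr rfl fun F _ => ?_
  rw [actTerm_eq]
  rw [dig_enc, tabS]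
  congr 1
  unfold val
  change _ = 8 * fi (h.face (symMapFace ρ ε F)) + pk (h.axisMap (symMapFace ρ ε F))
  rw [tabT, h1, h2]

theorem allS_iff (Q : ℕ × ℕ → Bool) (l : List (ℕ × ℕ)) : allS Q l = true ↔ ∀ a ∈ l, Q a = true := by
  induction l with
  | nil => simp [allS]
  | cons a l ih => cases h : Q a <;> simp [allS, h, ih]

theorem canonB_iff (g : Gluing) :
    canonB (enc g) = true ↔ ∀ h, EquivGluing g h → enc g ≤ enc h := by
  unfold canonB
  rw [allS_iff]
  constructor
  · rintro H h ⟨ρ, ε, h1, h2⟩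
    have := H _ (tab_mem ρ ε)
    rw [act_enc h1 h2] at this
    exact Nat.le_of_ble_eq_true this
  · intro H st hst
    obtain ⟨ρ, ε, rfl⟩ := mem_tab hst
    rw [act_enc (symGl_face ρ ε g) (symGl_axis ρ ε g)]
    exact Nat.ble_eq_true_of_le (H _ (symGl_equiv ρ ε g))

/-! ### Completeness of the enumeration -/

theorem beq_eq (x y : ℕ) : Nat.beq x y = (x == y) := by
  by_cases h : x = y
  · subst h; simp
  · rw [beq_false_of_ne h]
    cases hb : Nat.beq x y
    · rfl
    · exact absurd (Nat.eq_of_beq_eq_true hb) h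

theorem enum_sound (Q : ℕ → Bool) (s p : ℕ → ℕ)
    (hs : ∀ x < 8, s (s x) = x) (hne : ∀ x < 8, s x ≠ x)
    (hp : ∀ x < 8, p (s x) = invT (p x)) (hm : ∀ x < 8, p x ∈ permsFor x (s x)) :
    ∀ (n : ℕ) (rem : List ℕ) (acc : ℕ), rem.length = 2 * n → rem.Nodup →
      (∀ x ∈ rem, x < 8) → (∀ x ∈ rem, s x ∈ rem) → enumAll Q n rem acc = true →
      Q (acc + (rem.map fun x => (8 * s x + p x) * 64 ^ x).sum) = true := by
  intro n
  induction n with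
  | zero =>
    intro rem acc hl _ _ _ hE
    have : rem = [] := List.length_eq_zero_iff.1 (by omega)
    subst this
    simpa [enumAll] using hE
  | succ n ih =>
    intro rem acc hl hnd h8 hcl hE
    cases rem with
    | nil => simp at hl
    | cons a rest =>
      have ha : a < 8 := h8 a (by simp)
      have hb : s a ∈ rest := by
        rcases List.mem_cons.1 (hcl a (by simp)) with h | h
        · exact absurd h (hne a ha)
        · exact h
      have hnd' := (List.nodup_cons.1 hnd).2
      have hna := (List.nodup_cons.1 hnd).1
      have hsb : s a < 8 := h8 _ (List.mem_cons_of_mem _ hb)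
      simp only [enumAll, List.all_eq_true] at hE
      have hE' := hE (s a) hb (p a) (hm a ha)
      have hf : (rest.filter fun x => !(Nat.beq x (s a))) = rest.erase (s a) := by
        rw [hnd'.erase_eq_filter]
        congr 1
        funext x
        exact congrArg not (beq_eq x (s a))
      rw [hf] at hE'
      have key := ih (rest.erase (s a)) (acc + term a (s a) (p a)) ?_ (hnd'.erase _) ?_ ?_ hE'
      · have hsum := ((List.perm_cons_erase hb).map
          (fun x => (8 * s x + p x) * 64 ^ x)).sum_eq
        simp only [List.map_cons, List.sum_cons] at hsum ⊢
        rw [hsum]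
        have ht : term a (s a) (p a) = (8 * s a + p a) * 64 ^ a + 
            (8 * s (s a) + p (s a)) * 64 ^ s a := by
          rw [hs a ha, hp a ha]; rfl
        rw [ht] at key
        rw [← key]
        congr 1
        ring
      · rw [List.length_erase_of_mem hb]
        simp only [List.length_cons] at hl
        omega
      · intro x hx
        exact h8 x (List.mem_cons_of_mem _ (List.mem_of_mem_erase hx))
      · intro x hx
        rw [hnd'.mem_erase_iff] at hx ⊢
        have hx8 := h8 x (List.mem_cons_of_mem _ hx.2)
        refine ⟨fun h => ?_, ?_⟩
        · have : x = a := by rw [← hs x hx8, h, hs a ha]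
          exact hna (this ▸ hx.2)
        · rcases List.mem_cons.1 (hcl x (List.mem_cons_of_mem _ hx.2)) with h | h
          · exact absurd (by rw [← h, hs x hx8]) hx.1
          · exact h

theorem memB_iff (c : ℕ) (l : List ℕ) : memB c l = true ↔ c ∈ l := by
  induction l with
  | nil => simp [memB]
  | cons a l ih =>
    by_cases h : c = a
    · simp [memB, h]
    · have : Nat.beq c a = false := by rw [beq_eq]; exact beq_false_of_ne h
      simp [memB, this, ih, h]

theorem leaf_mem {c : ℕ} (h : leaf c = true) (hc : canonB c = true) : c ∈ reps := by
  rw [← memB_iff]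
  have h2 : leaf c = cond (canonB c) (memB c reps) true := force_eq c _
  rw [h2, hc, cond_true] at h
  exact h

theorem sum8 (t : ℕ → ℕ) : 0 + (([0, 1, 2, 3, 4, 5, 6, 7] : List ℕ).map t).sum =
    t 0 + t 1 + t 2 + t 3 + t 4 + t 5 + t 6 + t 7 := by
  simp only [List.map_cons, List.map_nil, List.sum_cons, List.sum_nil]
  ring

theorem enum_all (Q : ℕ → Bool) (hck : enumAll Q 4 [0, 1, 2, 3, 4, 5, 6, 7] 0 = true)
    (s p : ℕ → ℕ)
    (hs : ∀ x < 8, s (s x) = x) (hne : ∀ x < 8, s x ≠ x)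
    (hp : ∀ x < 8, p (s x) = invT (p x)) (hm : ∀ x < 8, p x ∈ permsFor x (s x))
    (h8 : ∀ x, s x < 8) (d : ℕ → ℕ) (hd : ∀ x, d x = 8 * s x + p x) (E : ℕ)
    (hE : E = d 0 * 64 ^ 0 + d 1 * 64 ^ 1 + d 2 * 64 ^ 2 + d 3 * 64 ^ 3 + d 4 * 64 ^ 4
      + d 5 * 64 ^ 5 + d 6 * 64 ^ 6 + d 7 * 64 ^ 7) :
    Q E = true := by
  have hE2 : 0 + (([0, 1, 2, 3, 4, 5, 6, 7] : List ℕ).map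
      fun x => (8 * s x + p x) * 64 ^ x).sum = E := by
    rw [sum8, hE]
    simp only [hd]
  rw [← hE2]
  refine enum_sound Q s p hs hne hp hm 4 [0, 1, 2, 3, 4, 5, 6, 7] 0 (by decide) (by decide)
    (by decide) (fun x _ => ?_) hck
  have := h8 x
  generalize s x = y at *
  simp only [List.mem_cons, List.not_mem_nil, or_false]
  omega

theorem mem_reps {g : Gluing} (hg : ∀ h, EquivGluing g h → enc g ≤ enc h) : enc g ∈ reps := by
  obtain ⟨h1, h2, h3, h4⟩ := g.2
  have key := enum_all leaf enum_check (fun x => fi (g.face (unfi x))) (fun x => pk (g.axisMap (unfi x)))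
    (fun x hx => by
      simp only [unfi_fi]
      change fi (g.1.1 (g.1.1 _)) = _
      rw [h1, fi_unfi x hx])
    (fun x hx h => by
      apply h2 (unfi x)
      apply fi_inj
      rw [fi_unfi x hx]
      exact h)
    (fun x hx => by
      simp only [unfi_fi]
      change pk (g.1.2 (g.1.1 _)) = _
      rw [h3, pk_inv]; rfl)
    (fun x hx => by
      have := (permsFor_iff (unfi x) (g.face (unfi x)) (g.axisMap (unfi x))).2 (h4 _)
      rwa [fi_unfi x hx] at this)
    (fun x => fi_lt _) (fun x => val g (unfi x)) (fun x => rfl) (enc g) (enc_eq g)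
  exact leaf_mem key ((canonB_iff g).2 hg)

/-! ### Decoding -/

theorem exists_dec {c : ℕ} (hc : c ∈ reps) : ∃ g : Gluing, enc g = c := by
  have hv := List.all_eq_true.1 valid_check c hc
  unfold validB at hv
  rw [Bool.and_eq_true, List.all_eq_true] at hv
  obtain ⟨hv, hlt⟩ := hv
  have hlt : c < 64 ^ 8 := Nat.le_of_ble_eq_true hlt
  have hmem : ∀ F : OctFace, fi F ∈ [0, 1, 2, 3, 4, 5, 6, 7] := by decide +kernel
  have hd : ∀ i, dig c i < 64 := fun i => by rw [dig_eq]; omega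
  have hperm : ∀ a b k, k ∈ permsFor a b → k < 6 := by
    intro a b k hk
    unfold permsFor at hk
    cases h : (parity a == parity b) <;> rw [h] at hk <;> simp at hk <;> omega
  let s : OctFace → OctFace := fun F => unfi (dig c (fi F) / 8)
  let p : OctFace → Equiv.Perm (Fin 3) := fun F => unpk (dig c (fi F) % 8)
  have hfs : ∀ F, fi (s F) = dig c (fi F) / 8 := fun F => by
    have := hd (fi F)
    exact fi_unfi _ (by omega)
  have H : ∀ F, pk (p F) = dig c (fi F) % 8 ∧ pk (p F) ∈ permsFor (fi F) (fi (s F)) ∧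
      dig c (fi (s F)) = 8 * fi F + invT (pk (p F)) ∧ fi (s F) ≠ fi F := by
    intro F
    have h := hv (fi F) (hmem F)
    rw [Bool.and_eq_true, Bool.and_eq_true, memB_iff] at h
    obtain ⟨a1, a2, a3⟩ := h
    have a2 := Nat.eq_of_beq_eq_true a2
    have e1 : pk (p F) = dig c (fi F) % 8 := pk_unpk _ (hperm _ _ _ a1)
    refine ⟨e1, ?_, ?_, ?_⟩
    · rw [e1, hfs]; exact a1
    · rw [e1, hfs]; exact a2
    · rw [hfs]
      intro e
      have : Nat.beq (Nat.div (dig c (fi F)) 8) (fi F) = true := by rw [beq_eq]; exact beq_iff_eq.2 e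
      rw [this] at a3
      exact absurd a3 (by decide)
  have hss : Function.Involutive s := by
    intro F
    apply fi_inj
    have h1 := H F
    rw [hfs, h1.2.2.1, ← pk_inv]
    have := pk_lt (p F)⁻¹
    omega
  let g : Gluing := ⟨(hss.toPerm s, p), by
    refine ⟨fun F => hss F, fun F h => (H F).2.2.2 (congrArg fi h), fun F => ?_, fun F => ?_⟩
    · change p (s F) = (p F)⁻¹
      apply pk_inj
      rw [(H (s F)).1, (H F).2.2.1, ← pk_inv]
      have := pk_lt (p F)⁻¹
      omega
    · exact (permsFor_iff _ _ _).1 (H F).2.1⟩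
  refine ⟨g, ?_⟩
  have hval : ∀ F, val g F = dig c (fi F) := by
    intro F
    change 8 * fi (s F) + pk (p F) = _
    rw [hfs, (H F).1]
    omega
  rw [enc_eq]
  simp only [hval]
  rw [fi_unfi 0 (by norm_num), fi_unfi 1 (by norm_num), fi_unfi 2 (by norm_num),
    fi_unfi 3 (by norm_num), fi_unfi 4 (by norm_num), fi_unfi 5 (by norm_num),
    fi_unfi 6 (by norm_num), fi_unfi 7 (by norm_num)]
  simp only [dig_eq]
  norm_num at hlt ⊢
  omega

/-- Counting orbits through canonical codes. -/
theorem count_orbits (P : Gluing → Prop) (T : ℕ → Bool)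
    (hinv : ∀ g h, EquivGluing g h → P g → P h) (hT : ∀ g, P g ↔ T (enc g) = true) :
    Nat.card {s : Set Gluing // ∃ g : Gluing, P g ∧ s = orbit g} = reps.countP T := by
  choose dec hdec using fun c (hc : c ∈ reps) => exists_dec hc
  have hcan : ∀ c hc h, EquivGluing (dec c hc) h → enc (dec c hc) ≤ enc h := by
    intro c hc
    rw [← canonB_iff, hdec]
    exact List.all_eq_true.1 canon_check c hc
  have hmem : ∀ c, c ∈ (reps.filter T).toFinset ↔ c ∈ reps ∧ T c = true := by
    intro c; rw [List.mem_toFinset, List.mem_filter]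
  let f : (reps.filter T).toFinset → {s : Set Gluing // ∃ g : Gluing, P g ∧ s = orbit g} :=
    fun c => ⟨orbit (dec c.1 ((hmem _).1 c.2).1), _, (hT _).2 (by
      rw [hdec]; exact ((hmem _).1 c.2).2), rfl⟩
  have hf : Function.Bijective f := by
    constructor
    · rintro ⟨c, hc⟩ ⟨d, hd⟩ h
      have e : EquivGluing _ _ := orbit_eq_iff.1 (congrArg Subtype.val h)
      have h1 := hcan _ _ _ e
      have h2 := hcan _ _ _ (equiv_symm e)
      have := le_antisymm h1 h2
      rw [hdec, hdec] at this
      exact Subtype.ext this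
    · rintro ⟨_, g, hg, rfl⟩
      obtain ⟨h, hh, hmin⟩ : ∃ h, EquivGluing g h ∧ ∀ k, EquivGluing g k → enc h ≤ enc k := by
        obtain ⟨n, ⟨h, hh, rfl⟩, hmin⟩ := WellFounded.has_min (wellFounded_lt (α := ℕ))
          {n | ∃ h, EquivGluing g h ∧ enc h = n} ⟨_, g, equiv_refl g, rfl⟩
        exact ⟨h, hh, fun k hk => not_lt.1 (hmin _ ⟨k, hk, rfl⟩)⟩
      have hr : enc h ∈ reps := mem_reps fun k hk => hmin k (equiv_trans hh hk)
      refine ⟨⟨enc h, (hmem _).2 ⟨hr, (hT _).1 (hinv _ _ hh hg)⟩⟩, ?_⟩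
      apply Subtype.ext
      change orbit (dec (enc h) hr) = orbit g
      rw [enc_inj (hdec (enc h) hr)]
      exact orbit_eq_iff.2 (equiv_symm hh)
  rw [← Nat.card_congr (Equiv.ofBijective f hf), Nat.card_eq_fintype_card, Fintype.card_coe,
    List.toFinset_card_of_nodup (nodup_check.filter _), List.countP_eq_length_filter]

/-! ### Invariance of the link data -/

theorem eqvGen_map {α β : Type} {r : α → α → Prop} {r' : β → β → Prop} {m : α → β}
    (h : ∀ a b, r a b → r' (m a) (m b)) {a b : α} (hab : Relation.EqvGen r a b) :
    Relation.EqvGen r' (m a) (m b) := by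
  induction hab with
  | rel x y hxy => exact .rel _ _ (h _ _ hxy)
  | refl x => exact .refl _
  | symm x y _ ih => exact .symm _ _ ih
  | trans x y z _ _ ih1 ih2 => exact .trans _ _ _ ih1 ih2

theorem eqvGen_equiv {α β : Type} {r : α → α → Prop} {r' : β → β → Prop} (m : α ≃ β)
    (h : ∀ a b, r a b ↔ r' (m a) (m b)) (a b : α) :
    Relation.EqvGen r a b ↔ Relation.EqvGen r' (m a) (m b) := by
  constructor
  · exact eqvGen_map fun a b => (h a b).1
  · intro hab
    have := eqvGen_map (r' := r) (m := m.symm) (fun a b hr => (h _ _).2 (by simpa using hr)) hab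
    simpa using this

/-- symmetry acting on vertices -/
def symV (ρ : Equiv.Perm (Fin 3)) (ε : OctFace) : OctVertex ≃ OctVertex where
  toFun v := (ρ v.1, Bool.xor v.2 (ε v.1))
  invFun v := (ρ⁻¹ v.1, Bool.xor v.2 (ε (ρ⁻¹ v.1)))
  left_inv v := by
    apply Prod.ext <;> simp
  right_inv v := by
    apply Prod.ext <;> simp

theorem symV_face (ρ ε) (F : OctFace) (i : Fin 3) :
    symV ρ ε (i, F i) = (ρ i, symMapFace ρ ε F (ρ i)) := by
  simp [symV, symMapFace]

/-- symmetry acting on edge-ends -/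
def symEE (ρ : Equiv.Perm (Fin 3)) (ε : OctFace) : EdgeEnd ≃ EdgeEnd :=
  ((symV ρ ε).prodCongr (symV ρ ε)).subtypeEquiv fun p => by
    change _ ↔ ρ p.1.1 ≠ ρ p.2.1
    exact (ρ.injective.ne_iff).symm

section Inv

variable {g h : Gluing} {ρ : Equiv.Perm (Fin 3)} {ε : OctFace}

theorem target_sym
    (h1 : ∀ F, h.face (symMapFace ρ ε F) = symMapFace ρ ε (g.face F))
    (h2 : ∀ F, h.axisMap (symMapFace ρ ε F) = ρ * g.axisMap F * ρ⁻¹) (F : OctFace) (i : Fin 3) :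
    symV ρ ε (g.axisMap F i, g.face F (g.axisMap F i)) =
      (h.axisMap (symMapFace ρ ε F) (ρ i),
        h.face (symMapFace ρ ε F) (h.axisMap (symMapFace ρ ε F) (ρ i))) := by
  rw [symV_face, h1, h2]
  simp

theorem vtxRel_sym
    (h1 : ∀ F, h.face (symMapFace ρ ε F) = symMapFace ρ ε (g.face F))
    (h2 : ∀ F, h.axisMap (symMapFace ρ ε F) = ρ * g.axisMap F * ρ⁻¹) (v w : OctVertex) :
    vtxRel g v w ↔ vtxRel h (symV ρ ε v) (symV ρ ε w) := by
  constructor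
  · rintro ⟨F, i, rfl, rfl⟩
    exact ⟨symMapFace ρ ε F, ρ i, symV_face _ _ _ _, target_sym h1 h2 F i⟩
  · rintro ⟨F', i', hv, hw⟩
    obtain ⟨F, rfl⟩ := (symE ρ ε).surjective F'
    obtain ⟨i, rfl⟩ := ρ.surjective i'
    refine ⟨F, i, (symV ρ ε).injective ?_, (symV ρ ε).injective ?_⟩
    · rw [symV_face]; exact hv
    · rw [target_sym h1 h2]; exact hw

theorem endRel_sym
    (h1 : ∀ F, h.face (symMapFace ρ ε F) = symMapFace ρ ε (g.face F))
    (h2 : ∀ F, h.axisMap (symMapFace ρ ε F) = ρ * g.axisMap F * ρ⁻¹) (p q : EdgeEnd) :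
    endRel g p q ↔ endRel h (symEE ρ ε p) (symEE ρ ε q) := by
  have hval : ∀ p : EdgeEnd, (symEE ρ ε p).1 = (symV ρ ε p.1.1, symV ρ ε p.1.2) := fun _ => rfl
  constructor
  · rintro ⟨F, i, j, hij, hp, hq⟩
    refine ⟨symMapFace ρ ε F, ρ i, ρ j, ρ.injective.ne hij, ?_, ?_⟩
    · rw [hval, hp, symV_face, symV_face]
    · rw [hval, hq, target_sym h1 h2, target_sym h1 h2]
  · rintro ⟨F', i', j', hij, hp, hq⟩
    obtain ⟨F, rfl⟩ := (symE ρ ε).surjective F'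
    obtain ⟨i, rfl⟩ := ρ.surjective i'
    obtain ⟨j, rfl⟩ := ρ.surjective j'
    rw [hval] at hp hq
    change _ = ((ρ i, symMapFace ρ ε F (ρ i)), (ρ j, symMapFace ρ ε F (ρ j))) at hp
    change _ = ((h.axisMap (symMapFace ρ ε F) (ρ i),
        h.face (symMapFace ρ ε F) (h.axisMap (symMapFace ρ ε F) (ρ i))),
      (h.axisMap (symMapFace ρ ε F) (ρ j),
        h.face (symMapFace ρ ε F) (h.axisMap (symMapFace ρ ε F) (ρ j)))) at hq
    rw [← symV_face, ← symV_face] at hp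
    rw [← target_sym h1 h2, ← target_sym h1 h2] at hq
    refine ⟨F, i, j, fun e => hij (congrArg ρ e), ?_, ?_⟩
    · exact Prod.ext ((symV ρ ε).injective (Prod.ext_iff.1 hp).1)
        ((symV ρ ε).injective (Prod.ext_iff.1 hp).2)
    · exact Prod.ext ((symV ρ ε).injective (Prod.ext_iff.1 hq).1)
        ((symV ρ ε).injective (Prod.ext_iff.1 hq).2)

end Inv

/-- Equivalent gluings have the same link data. -/
theorem link_equiv {g h : Gluing} (e : EquivGluing g h) :
    ∃ m : Quotient (vtxSetoid g) ≃ Quotient (vtxSetoid h), ∀ c, linkChi h (m c) = linkChi g c := by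
  obtain ⟨ρ, ε, h1, h2⟩ := e
  let m : Quotient (vtxSetoid g) ≃ Quotient (vtxSetoid h) :=
    Quotient.congr (symV ρ ε) fun a b => eqvGen_equiv (symV ρ ε) (vtxRel_sym h1 h2) a b
  let m' : Quotient (endSetoid g) ≃ Quotient (endSetoid h) :=
    Quotient.congr (symEE ρ ε) fun a b => eqvGen_equiv (symEE ρ ε) (endRel_sym h1 h2) a b
  have hm : ∀ v, m (Quotient.mk _ v) = Quotient.mk _ (symV ρ ε v) := fun _ => rfl
  have hm' : ∀ v, m' (Quotient.mk _ v) = Quotient.mk _ (symEE ρ ε v) := fun _ => rfl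
  refine ⟨m, fun c => ?_⟩
  have hs : classSize h (m c) = classSize g c := by
    refine (Nat.card_congr ((symV ρ ε).subtypeEquiv fun v => ?_)).symm
    rw [← hm, m.injective.eq_iff]
  have hc : cornerCount h (m c) = cornerCount g c := by
    refine (Nat.card_congr (m'.subtypeEquiv fun q => ?_)).symm
    constructor
    · rintro ⟨p, rfl, hp⟩
      refine ⟨symEE ρ ε p, (hm' p).symm, ?_⟩
      rw [← hp]; rfl
    · rintro ⟨p', hp1, hp2⟩
      obtain ⟨p, rfl⟩ := (symEE ρ ε).surjective p'
      refine ⟨p, m'.injective ((hm' p).trans hp1), m.injective ?_⟩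
      rw [← hp2]; rfl
  unfold linkChi
  rw [hs, hc]

theorem forall_link {g h : Gluing} (m : Quotient (vtxSetoid g) ≃ Quotient (vtxSetoid h))
    (hm : ∀ c, linkChi h (m c) = linkChi g c) (p : ℤ → Prop) (H : ∀ c, p (linkChi g c)) :
    ∀ c, p (linkChi h c) := by
  intro c
  obtain ⟨c, rfl⟩ := m.surjective c
  rw [hm]; exact H c

theorem card_link {g h : Gluing} (m : Quotient (vtxSetoid g) ≃ Quotient (vtxSetoid h))
    (hm : ∀ c, linkChi h (m c) = linkChi g c) (k : ℤ) :
    Nat.card {c // linkChi h c = k} = Nat.card {c // linkChi g c = k} :=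
  (Nat.card_congr (m.subtypeEquiv fun c => by rw [hm])).symm

/-! ### Correctness of the computation of the links -/

def mergeL (L : List ℕ) (a b : ℕ) : List ℕ :=
  L.map fun t => if t = nth L a then nth L b else t

def ufL : List (ℕ × ℕ) → List ℕ → List ℕ
  | [], L => L
  | p :: ps, L => ufL ps (mergeL L p.1 p.2)

theorem nth_map (f : ℕ → ℕ) (L : List ℕ) (i : ℕ) (hi : i < L.length) :
    nth (L.map f) i = f (nth L i) := by
  induction L generalizing i with
  | nil => simp at hi
  | cons a l ih =>
    cases i with
    | zero => rfl
    | succ i => exact ih i (by simpa using hi)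

theorem recolor_eq {α : Type} (x y : ℕ) (L : List ℕ) (k : List ℕ → α) :
    recolor x y L k = k (L.map fun t => if t = x then y else t) := by
  induction L generalizing k with
  | nil => rfl
  | cons a l ih =>
    change (Bool.rec (recolor x y l fun r => k (a :: r)) (recolor x y l fun r => k (y :: r))
      (Nat.beq a x) : α) = _
    rw [beq_eq]
    by_cases h : a = x
    · rw [beq_iff_eq.2 h, List.map_cons, if_pos h]
      exact ih _
    · rw [beq_false_of_ne h, List.map_cons, if_neg h]
      exact ih _

theorem merge_eq {α : Type} (L : List ℕ) (a b : ℕ) (k : List ℕ → α) :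
    merge L a b k = k (mergeL L a b) := by
  unfold merge mergeL
  rw [force_eq, force_eq, beq_eq]
  by_cases h : nth L a = nth L b
  · rw [beq_iff_eq.2 h, cond_true]
    congr 1
    conv_lhs => rw [← List.map_id L]
    refine List.map_congr_left fun t _ => ?_
    by_cases ht : t = nth L a
    · rw [if_pos ht, ← h, ← ht]; rfl
    · rw [if_neg ht]; rfl
  · rw [beq_false_of_ne h, cond_false, recolor_eq]

theorem uf_eq {α : Type} (ps : List (ℕ × ℕ)) (L : List ℕ) (k : List ℕ → α) :
    uf ps L k = k (ufL ps L) := by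
  induction ps generalizing L with
  | nil => rfl
  | cons p ps ih =>
    change merge L p.1 p.2 (fun M => uf ps M k) = _
    rw [merge_eq, ih]; rfl

theorem countN_eq (p : ℕ → Bool) (l : List ℕ) : countN p l = l.countP p := by
  induction l with
  | nil => rfl
  | cons a l ih =>
    change (Bool.rec (countN p l) (Nat.succ (countN p l)) (p a) : ℕ) = _
    rw [ih, List.countP_cons]
    cases p a <;> rfl

theorem mapK_eq {α : Type} (f : ℕ → ℕ) (l : List ℕ) (k : List ℕ → α) :
    mapK f l k = k (l.map f) := by
  induction l generalizing k with
  | nil => rfl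
  | cons a l ih =>
    change force (f a) (fun b => mapK f l fun r => k (b :: r)) = _
    rw [force_eq, ih]; rfl

section UF

variable {α : Type} {ι : α → ℕ} {n : ℕ} {r : α → α → Prop}

def UInv (ι : α → ℕ) (n : ℕ) (r : α → α → Prop) (L : List ℕ) : Prop :=
  L.length = n ∧ ∀ a, ∃ b, nth L (ι a) = ι b ∧ Relation.EqvGen r a b

theorem nth_mergeL {L : List ℕ} {a b i : ℕ} (hi : i < L.length) :
    nth (mergeL L a b) i = if nth L i = nth L a then nth L b else nth L i :=
  nth_map _ _ _ hi

theorem inv_merge (hι : Function.Injective ι) (hn : ∀ a, ι a < n) {L : List ℕ}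
    (hL : UInv ι n r L) {a b : α} (hab : r a b) : UInv ι n r (mergeL L (ι a) (ι b)) := by
  obtain ⟨hl, h⟩ := hL
  refine ⟨by simp [mergeL, hl], fun c => ?_⟩
  rw [nth_mergeL (by rw [hl]; exact hn c)]
  obtain ⟨c', hc1, hc2⟩ := h c
  by_cases e : nth L (ι c) = nth L (ι a)
  · rw [if_pos e]
    obtain ⟨a', ha1, ha2⟩ := h a
    obtain ⟨b', hb1, hb2⟩ := h b
    have : c' = a' := hι (by rw [← hc1, e, ha1])
    subst this
    exact ⟨b', hb1, .trans _ _ _ hc2 (.trans _ _ _ (.symm _ _ ha2)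
      (.trans _ _ _ (.rel _ _ hab) hb2))⟩
  · rw [if_neg e]
    exact ⟨c', hc1, hc2⟩

theorem uf_spec (hι : Function.Injective ι) (hn : ∀ a, ι a < n) (ps : List (ℕ × ℕ)) :
    ∀ L : List ℕ, UInv ι n r L → (∀ p ∈ ps, ∃ a b, p = (ι a, ι b) ∧ r a b) →
      UInv ι n r (ufL ps L) ∧
      (∀ a b, nth L (ι a) = nth L (ι b) → nth (ufL ps L) (ι a) = nth (ufL ps L) (ι b)) ∧
      ∀ p ∈ ps, nth (ufL ps L) p.1 = nth (ufL ps L) p.2 := by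
  induction ps with
  | nil => exact fun L hL _ => ⟨hL, fun a b h => h, by simp⟩
  | cons p ps ih =>
    intro L hL hps
    obtain ⟨a, b, rfl, hab⟩ := hps p (by simp)
    have hM := inv_merge hι hn hL hab
    obtain ⟨i1, i2, i3⟩ := ih _ hM fun q hq => hps q (List.mem_cons_of_mem _ hq)
    have hlen : ∀ c, ι c < L.length := fun c => by rw [hL.1]; exact hn c
    refine ⟨i1, fun c d hcd => i2 c d ?_, fun q hq => ?_⟩
    · rw [nth_mergeL (hlen c), nth_mergeL (hlen d), hcd]
    · rcases List.mem_cons.1 hq with rfl | hq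
      · apply i2 a b
        rw [nth_mergeL (hlen a), nth_mergeL (hlen b), if_pos rfl]
        split_ifs <;> rfl
      · exact i3 q hq

theorem uf_correct (hι : Function.Injective ι) (hn : ∀ a, ι a < n) (ps : List (ℕ × ℕ))
    (L : List ℕ) (hL : L.length = n) (hL' : ∀ i < n, nth L i = i)
    (hps : ∀ p, p ∈ ps ↔ ∃ a b, p = (ι a, ι b) ∧ r a b) :
    (∀ a b, nth (ufL ps L) (ι a) = nth (ufL ps L) (ι b) ↔ Relation.EqvGen r a b) ∧
    ∀ a, ∃ b, nth (ufL ps L) (ι a) = ι b ∧ Relation.EqvGen r a b := by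
  obtain ⟨⟨_, i1⟩, _, i3⟩ := uf_spec (r := r) hι hn ps L
    ⟨hL, fun a => ⟨a, hL' _ (hn a), .refl _⟩⟩ (fun p hp => (hps p).1 hp)
  refine ⟨fun a b => ⟨fun h => ?_, fun h => ?_⟩, i1⟩
  · obtain ⟨a', ha1, ha2⟩ := i1 a
    obtain ⟨b', hb1, hb2⟩ := i1 b
    have : a' = b' := hι (by rw [← ha1, h, hb1])
    subst this
    exact .trans _ _ _ ha2 (.symm _ _ hb2)
  · induction h with
    | rel x y hxy => exact i3 _ ((hps (ι x, ι y)).2 ⟨x, y, rfl, hxy⟩)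
    | refl x => rfl
    | symm x y _ ih => exact ih.symm
    | trans x y z _ _ ih1 ih2 => exact ih1.trans ih2

end UF

/-- Counting classes through their roots. -/
theorem card_roots {α : Type} (s : Setoid α) {ι : α → ℕ} (hι : Function.Injective ι)
    (f : ℕ → ℕ) (h1 : ∀ a b, f (ι a) = f (ι b) ↔ s a b) (h2 : ∀ a, ∃ b, f (ι a) = ι b ∧ s a b)
    (Q : Quotient s → Prop) :
    Nat.card {q // Q q} = Nat.card {a // f (ι a) = ι a ∧ Q (Quotient.mk s a)} := by
  let m : {a // f (ι a) = ι a ∧ Q (Quotient.mk s a)} → {q // Q q} :=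
    fun a => ⟨Quotient.mk s a.1, a.2.2⟩
  have hm : Function.Bijective m := by
    constructor
    · rintro ⟨a, ha, ha'⟩ ⟨b, hb, hb'⟩ h
      have h' : Quotient.mk s a = Quotient.mk s b := congrArg Subtype.val h
      have := (h1 a b).2 (Quotient.exact h')
      rw [ha, hb] at this
      exact Subtype.ext (hι this)
    · rintro ⟨q, hq⟩
      induction q using Quotient.inductionOn with
      | h a =>
        obtain ⟨b, hb1, hb2⟩ := h2 a
        have hab : Quotient.mk s b = Quotient.mk s a := Quotient.sound (s.symm hb2)
        refine ⟨⟨b, ?_, ?_⟩, Subtype.ext hab⟩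
        · rw [← (h1 a b).2 hb2, hb1]
        · rw [hab]; exact hq
  exact (Nat.card_congr (Equiv.ofBijective m hm)).symm

theorem card_list {α : Type} {ι : α → ℕ} (hι : Function.Injective ι) (l : List ℕ) (hl : l.Nodup)
    (hmem : ∀ i, i ∈ l ↔ ∃ a, ι a = i) (P : α → Prop) (p : ℕ → Bool)
    (hP : ∀ a, P a ↔ p (ι a) = true) : Nat.card {a // P a} = l.countP p := by
  let m : {a // P a} → (l.filter p).toFinset := fun a => ⟨ι a.1, by
    rw [List.mem_toFinset, List.mem_filter]
    exact ⟨(hmem _).2 ⟨_, rfl⟩, (hP _).1 a.2⟩⟩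
  have hm : Function.Bijective m := by
    constructor
    · rintro ⟨a, ha⟩ ⟨b, hb⟩ h
      exact Subtype.ext (hι (congrArg Subtype.val h))
    · rintro ⟨i, hi⟩
      rw [List.mem_toFinset, List.mem_filter, hmem] at hi
      obtain ⟨⟨a, rfl⟩, ha⟩ := hi
      exact ⟨⟨a, (hP a).2 ha⟩, rfl⟩
  rw [Nat.card_congr (Equiv.ofBijective m hm), Nat.card_eq_fintype_card, Fintype.card_coe,
    List.toFinset_card_of_nodup (hl.filter _), List.countP_eq_length_filter]

/-- index of a vertex -/
def ιV (v : OctVertex) : ℕ := 2 * v.1.val + v.2.toNat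

/-- index of an edge-end -/
def ιE (e : EdgeEnd) : ℕ := 6 * ιV e.1.1 + ιV e.1.2

theorem ιV_lt : ∀ v, ιV v < 6 := by decide +kernel
theorem ιV_inj : Function.Injective ιV := by
  have : ∀ v w, ιV v = ιV w → v = w := by decide +kernel
  exact this
theorem ιE_lt (e : EdgeEnd) : ιE e < 36 := by
  have := ιV_lt e.1.1
  have := ιV_lt e.1.2
  unfold ιE; omega
theorem ιE_inj : Function.Injective ιE := by
  intro e e' h
  have := ιV_lt e.1.2
  have := ιV_lt e'.1.2
  unfold ιE at h
  exact Subtype.ext (Prod.ext (ιV_inj (by omega)) (ιV_inj (by omega)))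
theorem ιE_div (e : EdgeEnd) : Nat.div (ιE e) 6 = ιV e.1.1 := by
  have := ιV_lt e.1.2
  change ιE e / 6 = _
  unfold ιE; omega

theorem mem_idxV (i : ℕ) : i ∈ idxV ↔ ∃ v, ιV v = i := by
  constructor
  · have : ∀ i ∈ idxV, ∃ v, ιV v = i := by decide +kernel
    exact this i
  · have : ∀ v, ιV v ∈ idxV := by decide +kernel
    rintro ⟨v, rfl⟩
    exact this v

theorem mem_idxE (i : ℕ) : i ∈ idxE ↔ ∃ e, ιE e = i := by
  constructor
  · have : ∀ i ∈ idxE, ∃ v w : OctVertex, v.1 ≠ w.1 ∧ 6 * ιV v + ιV w = i := by decide +kernel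
    intro hi
    obtain ⟨v, w, h, e⟩ := this i hi
    exact ⟨⟨(v, w), h⟩, e⟩
  · have : ∀ v w : OctVertex, v.1 ≠ w.1 → 6 * ιV v + ιV w ∈ idxE := by decide +kernel
    rintro ⟨e, rfl⟩
    exact this _ _ e.2

theorem fv_eq : ∀ (F : OctFace) (i : Fin 3), fv (fi F) i = ιV (i, F i) := by decide +kernel
theorem tv_eq' : ∀ (G : OctFace) (π : Equiv.Perm (Fin 3)) (i : Fin 3),
    tv (8 * fi G + pk π) i = ιV (π i, G (π i)) := by decide +kernel

theorem tv_eq (g : Gluing) (F : OctFace) (i : Fin 3) :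
    tv (dig (enc g) (fi F)) i = ιV (g.axisMap F i, g.face F (g.axisMap F i)) := by
  rw [dig_enc]
  exact tv_eq' _ _ _

theorem mem8 (x : ℕ) : x ∈ [0, 1, 2, 3, 4, 5, 6, 7] ↔ ∃ F, fi F = x := by
  constructor
  · intro hx
    refine ⟨unfi x, fi_unfi x ?_⟩
    simp only [List.mem_cons, List.not_mem_nil, or_false] at hx
    omega
  · rintro ⟨F, rfl⟩
    have := fi_lt F
    simp only [List.mem_cons, List.not_mem_nil, or_false]
    omega

theorem mem3 (x : ℕ) : x ∈ [0, 1, 2] ↔ ∃ i : Fin 3, i.val = x := by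
  constructor
  · intro hx
    refine ⟨⟨x, ?_⟩, rfl⟩
    simp only [List.mem_cons, List.not_mem_nil, or_false] at hx
    omega
  · rintro ⟨i, rfl⟩
    have := i.2
    simp only [List.mem_cons, List.not_mem_nil, or_false]
    omega

theorem mem33 (x : ℕ × ℕ) : x ∈ [(0, 1), (0, 2), (1, 0), (1, 2), (2, 0), (2, 1)] ↔
    ∃ i j : Fin 3, i ≠ j ∧ (i.val, j.val) = x := by
  constructor
  · have : ∀ x ∈ [(0, 1), (0, 2), (1, 0), (1, 2), (2, 0), (2, 1)],
      ∃ i j : Fin 3, i ≠ j ∧ (i.val, j.val) = x := by decide +kernel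
    exact this x
  · have : ∀ i j : Fin 3, i ≠ j →
      (i.val, j.val) ∈ [(0, 1), (0, 2), (1, 0), (1, 2), (2, 0), (2, 1)] := by decide +kernel
    rintro ⟨i, j, hij, rfl⟩
    exact this i j hij

theorem mem_pairsV (g : Gluing) (p : ℕ × ℕ) :
    p ∈ pairsV (enc g) ↔ ∃ a b, p = (ιV a, ιV b) ∧ vtxRel g a b := by
  unfold pairsV
  simp only [List.mem_flatMap, List.mem_map, mem8, mem3]
  constructor
  · rintro ⟨_, ⟨F, rfl⟩, _, ⟨i, rfl⟩, rfl⟩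
    exact ⟨_, _, by rw [fv_eq, tv_eq], F, i, rfl, rfl⟩
  · rintro ⟨_, _, rfl, F, i, rfl, rfl⟩
    exact ⟨_, ⟨F, rfl⟩, _, ⟨i, rfl⟩, by rw [fv_eq, tv_eq]⟩

theorem mem_pairsE (g : Gluing) (p : ℕ × ℕ) :
    p ∈ pairsE (enc g) ↔ ∃ a b, p = (ιE a, ιE b) ∧ endRel g a b := by
  unfold pairsE
  simp only [List.mem_flatMap, List.mem_map, mem8, mem33]
  constructor
  · rintro ⟨_, ⟨F, rfl⟩, _, ⟨i, j, hij, rfl⟩, rfl⟩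
    refine ⟨⟨((i, F i), (j, F j)), hij⟩, ⟨((g.axisMap F i, g.face F (g.axisMap F i)),
           (g.axisMap F j, g.face F (g.axisMap F j))), (g.axisMap F).injective.ne hij⟩, ?_,
           F, i, j, hij, rfl, rfl⟩
    simp only [fv_eq, tv_eq]
    rfl
  · rintro ⟨a, b, rfl, F, i, j, hij, ha, hb⟩
    refine ⟨_, ⟨F, rfl⟩, _, ⟨i, j, hij, rfl⟩, ?_⟩
    simp only [fv_eq, tv_eq, ιE, ha, hb]
    rfl

def LV (g : Gluing) : List ℕ := ufL (pairsV (enc g)) idxV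
def LE (g : Gluing) : List ℕ := ufL (pairsE (enc g)) idx36

theorem LV_spec (g : Gluing) :
    (∀ a b, nth (LV g) (ιV a) = nth (LV g) (ιV b) ↔ vtxSetoid g a b) ∧
    ∀ a, ∃ b, nth (LV g) (ιV a) = ιV b ∧ vtxSetoid g a b :=
  uf_correct ιV_inj ιV_lt _ _ rfl (by decide +kernel) (mem_pairsV g)

theorem LE_spec (g : Gluing) :
    (∀ a b, nth (LE g) (ιE a) = nth (LE g) (ιE b) ↔ endSetoid g a b) ∧
    ∀ a, ∃ b, nth (LE g) (ιE a) = ιE b ∧ endSetoid g a b :=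
  uf_correct ιE_inj ιE_lt _ _ rfl (by decide +kernel) (mem_pairsE g)

theorem mk_eq (g : Gluing) (a b : OctVertex) :
    Quotient.mk (vtxSetoid g) a = Quotient.mk (vtxSetoid g) b ↔
      nth (LV g) (ιV a) = nth (LV g) (ιV b) := by
  rw [(LV_spec g).1]
  exact ⟨fun h => Quotient.exact h, fun h => Quotient.sound h⟩

theorem classSize_eq (g : Gluing) (v : OctVertex) :
    classSize g (Quotient.mk _ v) = sizeN (LV g) (nth (LV g) (ιV v)) := by
  unfold sizeN
  rw [countN_eq]
  refine card_list ιV_inj _ (by decide) mem_idxV _ _ fun w => ?_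
  rw [mk_eq, beq_eq, beq_iff_eq]

theorem end_vtx (g : Gluing) {p q : EdgeEnd} (h : endSetoid g p q) :
    Quotient.mk (vtxSetoid g) p.1.1 = Quotient.mk (vtxSetoid g) q.1.1 := by
  apply Quotient.sound
  refine eqvGen_map (r := endRel g) (r' := vtxRel g) (m := fun p : EdgeEnd => p.1.1) ?_ h
  rintro a b ⟨F, i, j, _, ha, hb⟩
  exact ⟨F, i, by rw [ha], by rw [hb]⟩

theorem cornerCount_eq (g : Gluing) (v : OctVertex) :
    cornerCount g (Quotient.mk _ v) = cornerN (LV g) (LE g) (nth (LV g) (ιV v)) := by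
  unfold cornerN cornerCount
  rw [countN_eq, card_roots (endSetoid g) ιE_inj (nth (LE g)) (LE_spec g).1 (LE_spec g).2]
  refine card_list ιE_inj _ (by decide) mem_idxE _ _ fun e => ?_
  rw [ιE_div, beq_eq, beq_eq]
  have : (∃ p : EdgeEnd, Quotient.mk (endSetoid g) p = Quotient.mk (endSetoid g) e ∧
      Quotient.mk (vtxSetoid g) p.1.1 = Quotient.mk _ v) ↔
      nth (LV g) (ιV e.1.1) = nth (LV g) (ιV v) := by
    rw [← mk_eq]
    constructor
    · rintro ⟨p, h1, h2⟩
      rw [← h2]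
      exact (end_vtx g (Quotient.exact h1)).symm
    · intro h
      exact ⟨e, rfl, h⟩
  rw [this]
  cases h : (nth (LE g) (ιE e) == ιE e)
  · simp only [cond_false, Bool.false_eq_true, iff_false, not_and]
    intro h'
    exact absurd h' (by simpa using h)
  · simp only [cond_true, beq_iff_eq]
    exact and_iff_right (by simpa using h)

/-- list of shifted Euler characteristics -/
def XL (g : Gluing) : List ℕ := idxV.map (chiN (LV g) (LE g))

theorem withChi_eq {α : Type} (g : Gluing) (k : List ℕ → List ℕ → α) :
    withChi (enc g) k = k (LV g) (XL g) := by
  unfold withChi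
  rw [uf_eq, uf_eq, mapK_eq]
  rfl

theorem chi_eq (g : Gluing) (v : OctVertex) :
    linkChi g (Quotient.mk _ v) = (nth (XL g) (ιV v) : ℤ) - 6 := by
  have hX : nth (XL g) (ιV v) = cornerCount g (Quotient.mk _ v) + 6 -
      classSize g (Quotient.mk _ v) := by
    unfold XL
    rw [nth_map _ _ _ (ιV_lt v)]
    have h0 : ∀ i < 6, nth idxV i = i := by decide +kernel
    rw [h0 _ (ιV_lt v)]
    unfold chiN
    rw [force_eq, classSize_eq, cornerCount_eq]
    rfl
  have hs : classSize g (Quotient.mk _ v) ≤ 6 := by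
    rw [classSize_eq]
    unfold sizeN
    rw [countN_eq]
    exact List.countP_le_length
  unfold linkChi
  rw [hX]
  omega

theorem all_iff (g : Gluing) (P : ℤ → Prop) (p : ℕ → Bool)
    (hp : ∀ n : ℕ, P ((n : ℤ) - 6) ↔ p n = true) :
    (∀ c, P (linkChi g c)) ↔ allChi (XL g) p = true := by
  unfold allChi
  rw [List.all_eq_true]
  constructor
  · intro H i hi
    obtain ⟨v, rfl⟩ := (mem_idxV i).1 hi
    have := H (Quotient.mk _ v)
    rw [chi_eq, hp] at this
    exact this
  · intro H c
    induction c using Quotient.inductionOn with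
    | h v =>
      rw [chi_eq, hp]
      exact H _ ((mem_idxV _).2 ⟨v, rfl⟩)

theorem num_eq (g : Gluing) (k : ℕ) (z : ℤ) (hz : z = (k : ℤ) - 6) :
    Nat.card {c // linkChi g c = z} = numChi (LV g) (XL g) k := by
  unfold numChi
  rw [countN_eq, card_roots (vtxSetoid g) ιV_inj (nth (LV g)) (LV_spec g).1 (LV_spec g).2]
  refine card_list ιV_inj _ (by decide) mem_idxV _ _ fun v => ?_
  rw [chi_eq, beq_eq, beq_eq]
  cases h : (nth (LV g) (ιV v) == ιV v)
  · simp only [cond_false, Bool.false_eq_true, iff_false, not_and]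
    intro h'
    exact absurd h' (by simpa using h)
  · simp only [cond_true, beq_iff_eq]
    rw [and_iff_right (by simpa using h)]
    omega

theorem type0 (g : Gluing) : AllLinksSphere g ↔ typ T0 (enc g) = true := by
  unfold AllLinksSphere typ
  rw [withChi_eq]
  unfold T0
  exact all_iff g (fun x => x = 2) _ fun n => by rw [beq_eq, beq_iff_eq]; omega

theorem type1 (g : Gluing) : LinksOneTorus g ↔ typ T1 (enc g) = true := by
  unfold LinksOneTorus typ
  rw [withChi_eq]
  unfold T1
  rw [Bool.and_eq_true, num_eq g 6 0 (by norm_num), beq_eq, beq_iff_eq,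
    all_iff g (fun x => x = 2 ∨ x = 0) (fun x => Nat.beq x 8 || Nat.beq x 6) fun n => by
      rw [beq_eq, beq_eq, Bool.or_eq_true, beq_iff_eq, beq_iff_eq]; omega]

theorem type2 (g : Gluing) : LinksTwoTori g ↔ typ T2 (enc g) = true := by
  unfold LinksTwoTori typ
  rw [withChi_eq]
  unfold T2
  rw [Bool.and_eq_true, num_eq g 6 0 (by norm_num), beq_eq, beq_iff_eq,
    all_iff g (fun x => x = 2 ∨ x = 0) (fun x => Nat.beq x 8 || Nat.beq x 6) fun n => by
      rw [beq_eq, beq_eq, Bool.or_eq_true, beq_iff_eq, beq_iff_eq]; omega]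

theorem type3 (g : Gluing) : LinksGenusTwo g ↔ typ T3 (enc g) = true := by
  unfold LinksGenusTwo typ
  rw [withChi_eq]
  unfold T3
  rw [Bool.and_eq_true, num_eq g 4 (-2) (by norm_num), beq_eq, beq_iff_eq,
    all_iff g (fun x => x = 2 ∨ x = -2) (fun x => Nat.beq x 8 || Nat.beq x 4) fun n => by
      rw [beq_eq, beq_eq, Bool.or_eq_true, beq_iff_eq, beq_iff_eq]; omega]

theorem type4 (g : Gluing) : LinksGenusTwoTorus g ↔ typ T4 (enc g) = true := by
  unfold LinksGenusTwoTorus typ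
  rw [withChi_eq]
  unfold T4
  rw [Bool.and_eq_true, Bool.and_eq_true, num_eq g 4 (-2) (by norm_num),
    num_eq g 6 0 (by norm_num), beq_eq, beq_iff_eq, beq_eq, beq_iff_eq,
    all_iff g (fun x => x = 2 ∨ x = 0 ∨ x = -2)
      (fun x => Nat.beq x 8 || (Nat.beq x 6 || Nat.beq x 4)) fun n => by
      rw [beq_eq, beq_eq, beq_eq, Bool.or_eq_true, Bool.or_eq_true, beq_iff_eq, beq_iff_eq,
        beq_iff_eq]
      omega]

theorem type5 (g : Gluing) : LinksGenusThree g ↔ typ T5 (enc g) = true := by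
  unfold LinksGenusThree typ
  rw [withChi_eq]
  unfold T5
  rw [Bool.and_eq_true, num_eq g 2 (-4) (by norm_num), beq_eq, beq_iff_eq,
    all_iff g (fun x => x = 2 ∨ x = -4) (fun x => Nat.beq x 8 || Nat.beq x 2) fun n => by
      rw [beq_eq, beq_eq, Bool.or_eq_true, beq_iff_eq, beq_iff_eq]; omega]

theorem inv0 (g h : Gluing) (e : EquivGluing g h) (H : AllLinksSphere g) : AllLinksSphere h := by
  obtain ⟨m, hm⟩ := link_equiv e
  exact forall_link m hm (fun x => x = 2) H

theorem inv1 (g h : Gluing) (e : EquivGluing g h) (H : LinksOneTorus g) : LinksOneTorus h := by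
  obtain ⟨m, hm⟩ := link_equiv e
  exact ⟨forall_link m hm (fun x => x = 2 ∨ x = 0) H.1, (card_link m hm 0).trans H.2⟩

theorem inv2 (g h : Gluing) (e : EquivGluing g h) (H : LinksTwoTori g) : LinksTwoTori h := by
  obtain ⟨m, hm⟩ := link_equiv e
  exact ⟨forall_link m hm (fun x => x = 2 ∨ x = 0) H.1, (card_link m hm 0).trans H.2⟩

theorem inv3 (g h : Gluing) (e : EquivGluing g h) (H : LinksGenusTwo g) : LinksGenusTwo h := by
  obtain ⟨m, hm⟩ := link_equiv e
  exact ⟨forall_link m hm (fun x => x = 2 ∨ x = -2) H.1, (card_link m hm (-2)).trans H.2⟩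

theorem inv4 (g h : Gluing) (e : EquivGluing g h) (H : LinksGenusTwoTorus g) :
    LinksGenusTwoTorus h := by
  obtain ⟨m, hm⟩ := link_equiv e
  exact ⟨forall_link m hm (fun x => x = 2 ∨ x = 0 ∨ x = -2) H.1,
    (card_link m hm 0).trans H.2.1, (card_link m hm (-2)).trans H.2.2⟩

theorem inv5 (g h : Gluing) (e : EquivGluing g h) (H : LinksGenusThree g) :
    LinksGenusThree h := by
  obtain ⟨m, hm⟩ := link_equiv e
  exact ⟨forall_link m hm (fun x => x = 2 ∨ x = -4) H.1, (card_link m hm (-4)).trans H.2⟩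

/-! ### Final counts -/

theorem bits_spec {i : ℕ} {l : List ℕ} (h : l.all (typ (bitsIs i)) = true)
    (hl : ∀ c ∈ l, c ∈ reps) {c : ℕ} (hc : c ∈ l) :
    typ T0 c = (i == 0) ∧ typ T1 c = (i == 1) ∧ typ T2 c = (i == 2) ∧ typ T3 c = (i == 3) ∧
    typ T4 c = (i == 4) ∧ typ T5 c = (i == 5) := by
  obtain ⟨g, rfl⟩ := exists_dec (hl c hc)
  have h := List.all_eq_true.1 h _ hc
  unfold typ at h ⊢
  rw [withChi_eq] at h ⊢
  rw [withChi_eq, withChi_eq, withChi_eq, withChi_eq, withChi_eq]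
  unfold bitsIs at h
  simp only [Bool.and_eq_true, beq_iff_eq] at h
  obtain ⟨a0, a1, a2, a3, a4, a5⟩ := h
  simp only [a0, a1, a2, a3, a4, a5, beq_eq, and_self]

theorem countP_const {T : ℕ → Bool} {l : List ℕ} {b : Bool} (h : ∀ c ∈ l, T c = b) :
    l.countP T = cond b l.length 0 := by
  cases b
  · exact List.countP_eq_zero.2 fun c hc => by rw [h c hc]; decide
  · exact List.countP_eq_length.2 h

theorem countP_reps (T : ℕ → Bool) (b0 b1 b2 b3 b4 b5 : Bool)
    (h0 : ∀ c ∈ reps0, T c = b0) (h1 : ∀ c ∈ reps1, T c = b1) (h2 : ∀ c ∈ reps2, T c = b2)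
    (h3 : ∀ c ∈ reps3, T c = b3) (h4 : ∀ c ∈ reps4, T c = b4) (h5 : ∀ c ∈ reps5, T c = b5) :
    reps.countP T = cond b0 37 0 + (cond b1 81 0 + (cond b2 9 0 + (cond b3 113 0 +
      (cond b4 2 0 + cond b5 56 0)))) := by
  have l0 : reps0.length = 37 := by decide +kernel
  have l1 : reps1.length = 81 := by decide +kernel
  have l2 : reps2.length = 9 := by decide +kernel
  have l3 : reps3.length = 113 := by decide +kernel
  have l4 : reps4.length = 2 := by decide +kernel
  have l5 : reps5.length = 56 := by decide +kernel
  unfold reps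
  rw [List.countP_append, List.countP_append, List.countP_append, List.countP_append,
    List.countP_append, countP_const h0, countP_const h1, countP_const h2, countP_const h3,
    countP_const h4, countP_const h5, l0, l1, l2, l3, l4, l5]

theorem sub0 : ∀ c ∈ reps0, c ∈ reps := fun c h => by simp [reps, h]
theorem sub1 : ∀ c ∈ reps1, c ∈ reps := fun c h => by simp [reps, h]
theorem sub2 : ∀ c ∈ reps2, c ∈ reps := fun c h => by simp [reps, h]
theorem sub3 : ∀ c ∈ reps3, c ∈ reps := fun c h => by simp [reps, h]
theorem sub4 : ∀ c ∈ reps4, c ∈ reps := fun c h => by simp [reps, h]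
theorem sub5 : ∀ c ∈ reps5, c ∈ reps := fun c h => by simp [reps, h]

theorem cnt0 : reps.countP (typ T0) = 37 :=
  countP_reps _ _ _ _ _ _ _ (fun _ hc => (bits_spec chk0 sub0 hc).1)
    (fun _ hc => (bits_spec chk1 sub1 hc).1) (fun _ hc => (bits_spec chk2 sub2 hc).1)
    (fun _ hc => (bits_spec chk3 sub3 hc).1) (fun _ hc => (bits_spec chk4 sub4 hc).1)
    (fun _ hc => (bits_spec chk5 sub5 hc).1)

theorem cnt1 : reps.countP (typ T1) = 81 :=
  countP_reps _ _ _ _ _ _ _ (fun _ hc => (bits_spec chk0 sub0 hc).2.1)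
    (fun _ hc => (bits_spec chk1 sub1 hc).2.1) (fun _ hc => (bits_spec chk2 sub2 hc).2.1)
    (fun _ hc => (bits_spec chk3 sub3 hc).2.1) (fun _ hc => (bits_spec chk4 sub4 hc).2.1)
    (fun _ hc => (bits_spec chk5 sub5 hc).2.1)

theorem cnt2 : reps.countP (typ T2) = 9 :=
  countP_reps _ _ _ _ _ _ _ (fun _ hc => (bits_spec chk0 sub0 hc).2.2.1)
    (fun _ hc => (bits_spec chk1 sub1 hc).2.2.1) (fun _ hc => (bits_spec chk2 sub2 hc).2.2.1)
    (fun _ hc => (bits_spec chk3 sub3 hc).2.2.1) (fun _ hc => (bits_spec chk4 sub4 hc).2.2.1)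
    (fun _ hc => (bits_spec chk5 sub5 hc).2.2.1)

theorem cnt3 : reps.countP (typ T3) = 113 :=
  countP_reps _ _ _ _ _ _ _ (fun _ hc => (bits_spec chk0 sub0 hc).2.2.2.1)
    (fun _ hc => (bits_spec chk1 sub1 hc).2.2.2.1) (fun _ hc => (bits_spec chk2 sub2 hc).2.2.2.1)
    (fun _ hc => (bits_spec chk3 sub3 hc).2.2.2.1) (fun _ hc => (bits_spec chk4 sub4 hc).2.2.2.1)
    (fun _ hc => (bits_spec chk5 sub5 hc).2.2.2.1)

theorem cnt4 : reps.countP (typ T4) = 2 :=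
  countP_reps _ _ _ _ _ _ _ (fun _ hc => (bits_spec chk0 sub0 hc).2.2.2.2.1)
    (fun _ hc => (bits_spec chk1 sub1 hc).2.2.2.2.1)
    (fun _ hc => (bits_spec chk2 sub2 hc).2.2.2.2.1)
    (fun _ hc => (bits_spec chk3 sub3 hc).2.2.2.2.1)
    (fun _ hc => (bits_spec chk4 sub4 hc).2.2.2.2.1)
    (fun _ hc => (bits_spec chk5 sub5 hc).2.2.2.2.1)

theorem cnt5 : reps.countP (typ T5) = 56 :=
  countP_reps _ _ _ _ _ _ _ (fun _ hc => (bits_spec chk0 sub0 hc).2.2.2.2.2)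
    (fun _ hc => (bits_spec chk1 sub1 hc).2.2.2.2.2)
    (fun _ hc => (bits_spec chk2 sub2 hc).2.2.2.2.2)
    (fun _ hc => (bits_spec chk3 sub3 hc).2.2.2.2.2)
    (fun _ hc => (bits_spec chk4 sub4 hc).2.2.2.2.2)
    (fun _ hc => (bits_spec chk5 sub5 hc).2.2.2.2.2)

end OctCount

/-- classification of the `298` combinatorially inequivalent
orientation-reversing gluing patterns of the octahedron by the multiset of Euler
characteristics of the non-sphere vertex links: `37` with all links spheres, `81` with a
single torus link, `9` with two torus links, `113` with a single genus-2 link, `2` with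
one genus-2 and one torus link, and `56` with a single genus-3 link. -/
theorem count_gluings_by_boundary_type :
    Nat.card {s : Set Gluing // ∃ g : Gluing, AllLinksSphere g ∧ s = orbit g} = 37 ∧
    Nat.card {s : Set Gluing // ∃ g : Gluing, LinksOneTorus g ∧ s = orbit g} = 81 ∧
    Nat.card {s : Set Gluing // ∃ g : Gluing, LinksTwoTori g ∧ s = orbit g} = 9 ∧
    Nat.card {s : Set Gluing // ∃ g : Gluing, LinksGenusTwo g ∧ s = orbit g} = 113 ∧
    Nat.card {s : Set Gluing // ∃ g : Gluing, LinksGenusTwoTorus g ∧ s = orbit g} = 2 ∧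
    Nat.card {s : Set Gluing // ∃ g : Gluing, LinksGenusThree g ∧ s = orbit g} = 56 := by
  exact ⟨(OctCount.count_orbits _ _ OctCount.inv0 OctCount.type0).trans OctCount.cnt0,
    (OctCount.count_orbits _ _ OctCount.inv1 OctCount.type1).trans OctCount.cnt1,
    (OctCount.count_orbits _ _ OctCount.inv2 OctCount.type2).trans OctCount.cnt2,
    (OctCount.count_orbits _ _ OctCount.inv3 OctCount.type3).trans OctCount.cnt3,
    (OctCount.count_orbits _ _ OctCount.inv4 OctCount.type4).trans OctCount.cnt4,
    (OctCount.count_orbits _ _ OctCount.inv5 OctCount.type5).trans OctCount.cnt5⟩
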